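/- arXiv:2003.07652 — 8 statements merged into one kernel-verified Lean document; each statement's English description precedes it below -/
import Mathlib

section
/- Let G be a connected finite simple graph and H a finite simple graph with |V(G)| = |V(H)| and |V(G)| ≥ 2. Then h_H(G) = |E(H)| if and only if H is isomorphic to a subgraph of G (equivalently, there exists an injective graph homomorphism from H to G). -/
open SimpleGraph

/-- The sum `s_H(f,G) = Σ_{{x,y} ∈ E(H)} ρ_G(f(x), f(y))` of a pseudoordering
`f : V(H) → V(G)` of the graph `G` by the graph `H`. -/
noncomputable def sH {α β : Type} [Fintype α] (H : SimpleGraph α)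
    (G : SimpleGraph β) (f : α → β) : ℕ :=
  ∑ e ∈ H.edgeSet.toFinite.toFinset,
    Sym2.lift ⟨fun x y => G.dist (f x) (f y), fun _ _ => SimpleGraph.dist_comm⟩ e

/-- The lower `H`-Hamiltonian number `h_H(G)`: the minimum of `s_H(f,G)` over all
pseudoorderings (bijections) `f : V(H) → V(G)`. -/
noncomputable def lowerHH {α β : Type} [Fintype α] (H : SimpleGraph α)
    (G : SimpleGraph β) : ℕ :=
  sInf {m | ∃ f : α ≃ β, sH H G ⇑f = m}

/-- The upper `H`-Hamiltonian number `h_H⁺(G)`: the maximum of `s_H(f,G)` over all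
pseudoorderings (bijections) `f : V(H) → V(G)`. -/
noncomputable def upperHH {α β : Type} [Fintype α] (H : SimpleGraph α)
    (G : SimpleGraph β) : ℕ :=
  sSup {m | ∃ f : α ≃ β, sH H G ⇑f = m}

/-- The cyclic sum `s(f,G) = Σ_{i=1}^{n} ρ_G(f(i), f(i+1))` (indices cyclic) of an
ordering `f` of `G`. -/
noncomputable def cyclicSum {V : Type} {n : ℕ} (G : SimpleGraph V) (f : Fin n → V) : ℕ :=
  ∑ i : Fin n, G.dist (f i) (f ⟨(i.val + 1) % n, Nat.mod_lt _ i.pos⟩)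

/-- The open sum `s̄(f,G) = Σ_{i=1}^{n-1} ρ_G(f(i), f(i+1))` of an ordering `f` of `G`. -/
noncomputable def openSum {V : Type} {n : ℕ} (G : SimpleGraph V) (f : Fin n → V) : ℕ :=
  ∑ i : Fin n, if h : i.val + 1 < n then G.dist (f i) (f ⟨i.val + 1, h⟩) else 0

/-- Distinct vertices of a connected graph are at distance at least one, so every edge of `H`
contributes at least one to the sum of a pseudoordering. -/
theorem ncard_edgeSet_le_sH {α β : Type} [Fintype α] {H : SimpleGraph α} {G : SimpleGraph β}
    (hG : G.Connected) {f : α → β} (hf : Function.Injective f) :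
    H.edgeSet.ncard ≤ sH H G f := by
  rw [sH, Set.ncard_eq_toFinset_card _ H.edgeSet.toFinite, Finset.card_eq_sum_ones]
  refine Finset.sum_le_sum fun e he => ?_
  induction e with | h x y =>
  exact hG.pos_dist_of_ne (hf.ne (H.ne_of_adj (by simpa using he)))

/-- The sum of an injective pseudoordering equals the number of edges of `H` exactly when the
pseudoordering preserves adjacency. -/
theorem sH_eq_ncard_edgeSet_iff {α β : Type} [Fintype α] {H : SimpleGraph α}
    {G : SimpleGraph β} (hG : G.Connected) {f : α → β} (hf : Function.Injective f) :
    sH H G f = H.edgeSet.ncard ↔ ∀ x y, H.Adj x y → G.Adj (f x) (f y) := by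
  rw [sH, Set.ncard_eq_toFinset_card _ H.edgeSet.toFinite, Finset.card_eq_sum_ones, eq_comm,
    Finset.sum_eq_sum_iff_of_le]
  · constructor
    · intro h x y hxy
      exact SimpleGraph.dist_eq_one_iff_adj.mp (h s(x, y) (by simpa using hxy)).symm
    · intro h e he
      induction e with | h x y =>
      exact (SimpleGraph.dist_eq_one_iff_adj.mpr (h x y (by simpa using he))).symm
  · intro e he
    induction e with | h x y =>
    exact hG.pos_dist_of_ne (hf.ne (H.ne_of_adj (by simpa using he)))

theorem stmt1 {α β : Type} [Fintype α] [Fintype β]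
    (H : SimpleGraph α) (G : SimpleGraph β) (hG : G.Connected)
    (hcard : Fintype.card α = Fintype.card β) (h2 : 2 ≤ Fintype.card β) :
    lowerHH H G = H.edgeSet.ncard ↔ ∃ φ : H →g G, Function.Injective ⇑φ := by
  have hne : {m | ∃ f : α ≃ β, sH H G ⇑f = m}.Nonempty :=
    ⟨_, Fintype.equivOfCardEq hcard, rfl⟩
  constructor
  · intro h
    obtain ⟨f, hf⟩ := Nat.sInf_mem hne
    exact ⟨⟨f, fun {x y} => (sH_eq_ncard_edgeSet_iff hG f.injective).mp (hf.trans h) x y⟩,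
      f.injective⟩
  · rintro ⟨φ, hφ⟩
    refine le_antisymm (Nat.sInf_le ?_) (le_csInf hne ?_)
    · exact ⟨Equiv.ofBijective φ ((Fintype.bijective_iff_injective_and_card φ).mpr ⟨hφ, hcard⟩),
        (sH_eq_ncard_edgeSet_iff hG hφ).mpr fun _ _ => φ.map_adj⟩
    · rintro _ ⟨f, rfl⟩
      exact ncard_edgeSet_le_sH hG f.injective
end

section
/- Let T be a finite tree, let {w,u} be an edge of T, let l be a vertex in the connected component of u in T − {w,u}, and let T̄ be the tree with edge set (E(T) \ {{w,u}}) ∪ {{w,l}}. If x lies in the connected component of w and y lies in the connected component of u in T − {w,u}, then ρ_T̄(x,y) = ρ_T(x,w) + 1 + ρ_T(l,y); consequently ρ_T̄(x,y) + ρ_T(u,y) = ρ_T(x,y) + ρ_T(l,y). -/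
open SimpleGraph

namespace SimpleGraph

theorem Reachable.le_add_dist_of_forall_adj {V : Type*} {G : SimpleGraph V} {f : V → ℕ}
    (hf : ∀ ⦃v v'⦄, G.Adj v v' → f v' ≤ f v + 1) {x y : V} (h : G.Reachable x y) :
    f y ≤ f x + G.dist x y := by
  obtain ⟨p, hp⟩ := h.exists_walk_length_eq_dist
  rw [← hp]
  clear hp h
  induction p with
  | nil => simp
  | cons hadj p ih =>
    have := hf hadj
    rw [Walk.length_cons]
    omega

/-- The distance from `x` in `F ⊔ edge a b`, when `x` lies in the component of `a` in `F` and
`y` in the component of `a` or `b`, is at least the distance measured through the bridge. -/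
theorem ite_dist_le_dist_sup_edge {V : Type*} {F : SimpleGraph V} {a b x y : V}
    [Decidable (F.Reachable a y)] (hab : ¬ F.Reachable a b) (hx : F.Reachable a x)
    (h : (F ⊔ edge a b).Reachable x y) :
    (if F.Reachable a y then F.dist x y else F.dist x a + 1 + F.dist b y) ≤
      (F ⊔ edge a b).dist x y := by
  classical
  let f : V → ℕ := fun v ↦
    if F.Reachable a v then F.dist x v else F.dist x a + 1 + F.dist b v
  have hf : ∀ ⦃v v'⦄, (F ⊔ edge a b).Adj v v' → f v' ≤ f v + 1 := by
    intro v v' hv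
    rw [sup_adj, edge_adj] at hv
    rcases hv with hv | ⟨⟨rfl, rfl⟩ | ⟨rfl, rfl⟩, -⟩
    · have hiff : F.Reachable a v ↔ F.Reachable a v' :=
        ⟨fun h ↦ h.trans hv.reachable, fun h ↦ h.trans hv.symm.reachable⟩
      have h₁ := hv.diff_dist_adj (u := x)
      have h₂ := hv.diff_dist_adj (u := b)
      simp only [f, hiff]
      split_ifs <;> omega
    · simp [f, hab]
    · simp [f, hab]
      omega
  have hfx : f x = 0 := by simp [f, hx]
  have := h.le_add_dist_of_forall_adj hf
  rw [hfx, zero_add] at this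
  convert this

theorem Reachable.dist_sup_edge_of_reachable {V : Type*} {F : SimpleGraph V} {a b x y : V}
    (hab : ¬ F.Reachable a b) (hx : F.Reachable a x) (hy : F.Reachable a y) :
    (F ⊔ edge a b).dist x y = F.dist x y := by
  classical
  have hxy : F.Reachable x y := hx.symm.trans hy
  refine le_antisymm (hxy.dist_anti le_sup_left) ?_
  simpa [hy] using ite_dist_le_dist_sup_edge hab hx (hxy.mono le_sup_left)

theorem Reachable.dist_sup_edge_of_not_reachable {V : Type*} {F : SimpleGraph V} {a b x y : V}
    (hab : ¬ F.Reachable a b) (hx : F.Reachable a x) (hy : F.Reachable b y) :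
    (F ⊔ edge a b).dist x y = F.dist x a + 1 + F.dist b y := by
  classical
  have hay : ¬ F.Reachable a y := fun h ↦ hab (h.trans hy.symm)
  have hne : a ≠ b := fun h ↦ hab (h ▸ .rfl)
  have hadj : (F ⊔ edge a b).Adj a b := by simp [edge_adj, hne]
  obtain ⟨p, hp⟩ := hx.symm.exists_walk_length_eq_dist
  obtain ⟨q, hq⟩ := hy.exists_walk_length_eq_dist
  let r : (F ⊔ edge a b).Walk x y :=
    ((p.mapLe le_sup_left).concat hadj).append (q.mapLe le_sup_left)
  refine le_antisymm ?_ (by simpa [hay] using ite_dist_le_dist_sup_edge hab hx r.reachable)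
  have := dist_le r
  simpa [r, hp, hq] using this

end SimpleGraph

theorem stmt6 {V : Type} [Fintype V] {T : SimpleGraph V} (hT : T.IsTree)
    {w u : V} (he : T.Adj w u) {l : V}
    (hl : (T.deleteEdges {s(w, u)}).Reachable u l) (x y : V)
    (hx : (T.deleteEdges {s(w, u)}).Reachable w x)
    (hy : (T.deleteEdges {s(w, u)}).Reachable u y) :
    (fromEdgeSet ((T.edgeSet \ {s(w, u)}) ∪ {s(w, l)})).dist x y
        = T.dist x w + 1 + T.dist l y ∧
    (fromEdgeSet ((T.edgeSet \ {s(w, u)}) ∪ {s(w, l)})).dist x y + T.dist u y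
        = T.dist x y + T.dist l y := by
  set F := T.deleteEdges {s(w, u)} with hF
  have hwu : ¬ F.Reachable w u :=
    isAcyclic_iff_forall_adj_isBridge.mp hT.isAcyclic he
  have hwl : ¬ F.Reachable w l := fun h ↦ hwu (h.trans hl.symm)
  have hT' : T = F ⊔ edge w u := by
    ext v v'
    have hne := he.ne
    simp only [hF, sup_adj, deleteEdges_adj, edge_adj, Set.mem_singleton_iff, Sym2.eq_iff]
    grind [SimpleGraph.Adj.symm, SimpleGraph.Adj.ne]
  have hT'' : T = F ⊔ edge u w := by rw [edge_comm, ← hT']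
  have hbar : fromEdgeSet ((T.edgeSet \ {s(w, u)}) ∪ {s(w, l)}) = F ⊔ edge w l := by
    rw [fromEdgeSet_union, ← edgeSet_deleteEdges, fromEdgeSet_edgeSet]
    rfl
  have huw : ¬ F.Reachable u w := fun h ↦ hwu h.symm
  have hxw : T.dist x w = F.dist x w := by
    rw [hT', Reachable.dist_sup_edge_of_reachable hwu hx .rfl]
  have hly : T.dist l y = F.dist l y := by
    rw [hT'', Reachable.dist_sup_edge_of_reachable huw hl hy]
  have huy : T.dist u y = F.dist u y := by
    rw [hT'', Reachable.dist_sup_edge_of_reachable huw .rfl hy]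
  have hxy : T.dist x y = F.dist x w + 1 + F.dist u y := by
    rw [hT', Reachable.dist_sup_edge_of_not_reachable hwu hx hy]
  rw [hbar, Reachable.dist_sup_edge_of_not_reachable hwl hx (hl.symm.trans hy)]
  omega
end

section
/- Let G and H be finite simple graphs such that G is connected, |V(G)| = |V(H)| ≥ 2, and let f : V(H) → V(G) be a pseudoordering. Then there exists a pseudoordering g : V(H) → V(P_{|V(G)|−1}) of the path graph on |V(G)| vertices by H such that s_H(f,G) ≤ s_H(g, P_{|V(G)|−1}). -/
open SimpleGraph

/-- In a path graph, the difference of two positions is at most the graph distance. -/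
theorem abs_sub_le_dist_pathGraph {n : ℕ} (i j : Fin n) :
    |(i : ℤ) - j| ≤ (pathGraph n).dist i j := by
  have walk_bound : ∀ {i j : Fin n} (p : (pathGraph n).Walk i j), |(i : ℤ) - j| ≤ p.length := by
    intro i j p
    induction p with
    | nil => simp
    | cons h p ih =>
      rw [pathGraph_adj] at h
      rw [Walk.length_cons]
      push_cast
      rw [abs_le] at ih ⊢
      omega
  obtain _ | n := n
  · exact i.elim0
  obtain ⟨p, hp⟩ := (pathGraph_connected n).exists_walk_length_eq_dist i j
  exact hp ▸ walk_bound p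

/-- A weighted sum of distances to a point of an interval is maximised at an endpoint. -/
theorem sum_mul_abs_sub_le_endpoint {β : Type*} (S : Finset β) (c g : β → ℤ) {m i : ℤ}
    (hc : ∀ y ∈ S, 0 ≤ c y) (hg : ∀ y ∈ S, 0 ≤ g y ∧ g y ≤ m) (hi : 0 ≤ i) (him : i ≤ m) :
    ∑ y ∈ S, c y * |i - g y| ≤ ∑ y ∈ S, c y * g y ∨
      ∑ y ∈ S, c y * |i - g y| ≤ ∑ y ∈ S, c y * (m - g y) := by
  have key : m * ∑ y ∈ S, c y * |i - g y| ≤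
      (m - i) * ∑ y ∈ S, c y * g y + i * ∑ y ∈ S, c y * (m - g y) := by
    simp only [Finset.mul_sum, ← Finset.sum_add_distrib]
    refine Finset.sum_le_sum fun y hy => ?_
    obtain ⟨h0, h1⟩ := hg y hy
    have h : m * |i - g y| ≤ (m - i) * g y + i * (m - g y) := by
      rcases abs_cases (i - g y) with ⟨h, _⟩ | ⟨h, _⟩ <;> rw [h] <;> nlinarith
    nlinarith [mul_le_mul_of_nonneg_left h (hc y hy)]
  rcases hi.eq_or_lt with rfl | hi
  · left
    refine Finset.sum_le_sum fun y hy => ?_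
    rw [zero_sub, abs_neg, abs_of_nonneg (hg y hy).1]
  · by_contra! h
    nlinarith [mul_le_mul_of_nonneg_left h.1.le (sub_nonneg.2 him), mul_lt_mul_of_pos_left h.2 hi]

/-- `D`-sums over pairs from `S` are dominated by the corresponding sums for some placement of
`S` on `{0, …, |S| - 1}`, whatever the nonnegative weights. -/
def LinearlyDominated {β : Type*} (D : β → β → ℤ) (S : Finset β) : Prop :=
  ∀ w : β → β → ℤ, (∀ x y, 0 ≤ w x y) → ∃ g : β → ℤ, Set.InjOn g S ∧
    (∀ x ∈ S, 0 ≤ g x ∧ g x < S.card) ∧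
    ∑ x ∈ S, ∑ y ∈ S, w x y * D x y ≤ ∑ x ∈ S, ∑ y ∈ S, w x y * |g x - g y|

theorem sum_sum_insert_of_diag_eq_zero {β : Type*} [DecidableEq β] {S : Finset β} {l : β}
    (hl : l ∉ S) (w D : β → β → ℤ) (hsymm : ∀ x y, D x y = D y x) (hdiag : D l l = 0) :
    ∑ x ∈ insert l S, ∑ y ∈ insert l S, w x y * D x y =
      ∑ x ∈ S, ∑ y ∈ S, w x y * D x y + ∑ y ∈ S, (w l y + w y l) * D l y := by
  simp only [Finset.sum_insert hl, hdiag, mul_zero, zero_add, Finset.sum_add_distrib, add_mul]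
  simp only [hsymm _ l]
  ring

theorem LinearlyDominated.insert_of_le_add_one {β : Type*} [DecidableEq β] {D : β → β → ℤ} {S : Finset β}
    (hS : LinearlyDominated D S) (hsymm : ∀ x y, D x y = D y x) {u l : β} (hdiag : D l l = 0)
    (hu : u ∈ S) (hl : l ∉ S) (hD : ∀ y ∈ S, D l y ≤ D u y + 1) :
    LinearlyDominated D (insert l S) := by
  intro w hw
  set c : β → ℤ := fun y => w l y + w y l
  have hc0 : ∀ y, 0 ≤ c y := fun y => add_nonneg (hw _ _) (hw _ _)
  have split : ∀ E : β → β → ℤ, ∑ x ∈ S, ∑ y ∈ S, (w x y + if x = u then c y else 0) * E x y =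
      ∑ x ∈ S, ∑ y ∈ S, w x y * E x y + ∑ y ∈ S, c y * E u y := by
    intro E
    simp only [add_mul, Finset.sum_add_distrib, ite_mul, zero_mul]
    congr 1
    rw [Finset.sum_comm]
    simp [hu]
  obtain ⟨g, hinj, hg, hle⟩ := hS (fun x y => w x y + if x = u then c y else 0) fun x y => by
    have := hw x y
    have := hc0 y
    split_ifs <;> omega
  rw [split, split] at hle
  have hDc : ∑ y ∈ S, c y * D l y ≤ ∑ y ∈ S, c y * D u y + ∑ y ∈ S, c y := by
    rw [← Finset.sum_add_distrib]
    refine Finset.sum_le_sum fun y hy => ?_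
    nlinarith [mul_le_mul_of_nonneg_left (hD y hy) (hc0 y)]
  have hne : ∀ x ∈ S, x ≠ l := fun x hx h => hl (h ▸ hx)
  have hsum : ∀ g' : β → ℤ, (∀ x ∈ S, ∀ y ∈ S, |g' x - g' y| = |g x - g y|) →
      ∑ y ∈ S, c y * |g u - g y| + ∑ y ∈ S, c y ≤ ∑ y ∈ S, c y * |g' l - g' y| →
      ∑ x ∈ insert l S, ∑ y ∈ insert l S, w x y * D x y ≤
        ∑ x ∈ insert l S, ∑ y ∈ insert l S, w x y * |g' x - g' y| := by
    intro g' hg' hend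
    rw [sum_sum_insert_of_diag_eq_zero hl w D hsymm hdiag,
      sum_sum_insert_of_diag_eq_zero hl w (fun x y => |g' x - g' y|)
        (fun x y => abs_sub_comm _ _) (by simp)]
    have : ∑ x ∈ S, ∑ y ∈ S, w x y * |g' x - g' y| = ∑ x ∈ S, ∑ y ∈ S, w x y * |g x - g y| :=
      Finset.sum_congr rfl fun x hx => Finset.sum_congr rfl fun y hy => by rw [hg' x hx y hy]
    rw [this]
    linarith
  have hcard : ((insert l S).card : ℤ) = S.card + 1 := by simp [hl]
  rcases sum_mul_abs_sub_le_endpoint S c g (m := S.card - 1) (i := g u) (fun y _ => hc0 y)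
    (fun y hy => ⟨(hg y hy).1, by have := (hg y hy).2; omega⟩) (hg u hu).1
    (by have := (hg u hu).2; omega) with h | h
  · refine ⟨fun x => if x = l then 0 else g x + 1, ?_, ?_, hsum _ ?_ ?_⟩
    · intro x hx y hy hxy
      simp only [Finset.coe_insert, Set.mem_insert_iff, Finset.mem_coe] at hx hy
      rcases hx with rfl | hx <;> rcases hy with rfl | hy
      · rfl
      · have := (hg y hy).1
        simp [hne y hy] at hxy
        omega
      · have := (hg x hx).1
        simp [hne x hx] at hxy
        omega
      · simp [hne x hx, hne y hy] at hxy
        exact hinj hx hy hxy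
    · intro x hx
      rw [hcard]
      rcases Finset.mem_insert.1 hx with rfl | hx
      · simp only [if_true]
        omega
      · have := hg x hx
        simp only [hne x hx, if_false]
        omega
    · intro x hx y hy
      simp [hne x hx, hne y hy]
    · refine (add_le_add_left h _).trans (le_of_eq ?_)
      rw [← Finset.sum_add_distrib]
      refine Finset.sum_congr rfl fun y hy => ?_
      have := (hg y hy).1
      simp only [hne y hy, if_true, if_false]
      rw [zero_sub, abs_neg, abs_of_nonneg (by omega)]
      ring
  · refine ⟨fun x => if x = l then S.card else g x, ?_, ?_, hsum _ ?_ ?_⟩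
    · intro x hx y hy hxy
      simp only [Finset.coe_insert, Set.mem_insert_iff, Finset.mem_coe] at hx hy
      rcases hx with rfl | hx <;> rcases hy with rfl | hy
      · rfl
      · have := (hg y hy).2
        simp [hne y hy] at hxy
        omega
      · have := (hg x hx).2
        simp [hne x hx] at hxy
        omega
      · simp [hne x hx, hne y hy] at hxy
        exact hinj hx hy hxy
    · intro x hx
      rw [hcard]
      rcases Finset.mem_insert.1 hx with rfl | hx
      · simp only [if_true]
        omega
      · have := hg x hx
        simp only [hne x hx, if_false]
        omega
    · intro x hx y hy
      simp [hne x hx, hne y hy]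
    · refine (add_le_add_left h _).trans (le_of_eq ?_)
      rw [← Finset.sum_add_distrib]
      refine Finset.sum_congr rfl fun y hy => ?_
      have := (hg y hy).2
      simp only [hne y hy, if_true, if_false]
      rw [abs_of_nonneg (by omega)]
      ring

theorem exists_adj_mem_notMem {β : Type*} {G : SimpleGraph β} (hG : G.Connected) {S : Finset β}
    {a b : β} (ha : a ∈ S) (hb : b ∉ S) : ∃ u ∈ S, ∃ l ∉ S, G.Adj u l := by
  obtain ⟨p⟩ := hG.preconnected a b
  obtain ⟨d, -, h1, h2⟩ := p.exists_boundary_dart (S : Set β) ha hb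
  exact ⟨d.fst, h1, d.snd, h2, d.adj⟩

theorem linearlyDominated_univ {β : Type*} [Fintype β] {G : SimpleGraph β} (hG : G.Connected) :
    LinearlyDominated (fun x y => (G.dist x y : ℤ)) Finset.univ := by
  classical
  obtain ⟨a⟩ := hG.nonempty
  have grow : ∀ k < Fintype.card β, ∃ S : Finset β, a ∈ S ∧ S.card = k + 1 ∧
      LinearlyDominated (fun x y => (G.dist x y : ℤ)) S := by
    intro k
    induction k with
    | zero =>
      intro _
      exact ⟨{a}, by simp, by simp, fun w _ => ⟨fun _ => 0, by simp, by simp, by simp⟩⟩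
    | succ k ih =>
      intro hk
      obtain ⟨S, ha, hcard, hS⟩ := ih (by omega)
      obtain ⟨b, hb⟩ : ∃ b, b ∉ S := by
        by_contra! h
        rw [Finset.eq_univ_iff_forall.2 h, Finset.card_univ] at hcard
        omega
      obtain ⟨u, hu, l, hl, hul⟩ := exists_adj_mem_notMem hG ha hb
      refine ⟨insert l S, by simp [ha], by simp [hl, hcard],
        hS.insert_of_le_add_one (fun x y => by rw [G.dist_comm]) (by simp) hu hl fun y _ => ?_⟩
      have h1 := hG.dist_triangle (u := l) (v := u) (w := y)
      have h2 : G.dist l u = 1 := dist_eq_one_iff_adj.2 hul.symm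
      omega
  have hpos : 0 < Fintype.card β := Fintype.card_pos_iff.2 ⟨a⟩
  obtain ⟨S, -, hcard, hS⟩ := grow (Fintype.card β - 1) (by omega)
  rwa [← Finset.eq_univ_of_card S (by omega)]

theorem sH_eq_sum_out {α β : Type} [Fintype α] (H : SimpleGraph α) (G : SimpleGraph β)
    (f : α → β) :
    sH H G f = ∑ e ∈ H.edgeSet.toFinite.toFinset, G.dist (f e.out.1) (f e.out.2) :=
  Finset.sum_congr rfl fun e _ =>
    (congrArg (Sym2.lift ⟨fun x y => G.dist (f x) (f y), fun _ _ => dist_comm⟩) (Quot.out_eq e)).symm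

theorem stmt8 {α β : Type} [Fintype α] [Fintype β]
    (H : SimpleGraph α) (G : SimpleGraph β) (hG : G.Connected)
    (hcard : Fintype.card α = Fintype.card β) (h2 : 2 ≤ Fintype.card β)
    (f : α ≃ β) :
    ∃ g : α ≃ Fin (Fintype.card β),
      sH H G ⇑f ≤ sH H (pathGraph (Fintype.card β)) ⇑g := by
  classical
  set E := H.edgeSet.toFinite.toFinset
  let w : β → β → ℤ := fun x y => (E.filter fun e => f e.out.1 = x ∧ f e.out.2 = y).card
  have hw : ∀ D : β → β → ℤ,
      ∑ x, ∑ y, w x y * D x y = ∑ e ∈ E, D (f e.out.1) (f e.out.2) := by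
    intro D
    rw [← Finset.sum_fiberwise E fun e => (f e.out.1, f e.out.2), Fintype.sum_prod_type]
    refine Finset.sum_congr rfl fun x _ => Finset.sum_congr rfl fun y _ => ?_
    rw [Finset.sum_congr rfl (g := fun _ => D x y) fun e he => ?_]
    · simp [w, Prod.ext_iff]
    · simp only [Finset.mem_filter, Prod.mk.injEq] at he
      rw [he.2.1, he.2.2]
  obtain ⟨g, hinj, hg, hle⟩ := linearlyDominated_univ hG w fun _ _ => Int.natCast_nonneg _
  simp only [Finset.mem_univ, true_imp_iff, Finset.card_univ] at hg
  let g' : β → Fin (Fintype.card β) := fun x => ⟨(g x).toNat, by have := hg x; omega⟩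
  have hg' : ∀ x, ((g' x : ℕ) : ℤ) = g x := fun x => Int.toNat_of_nonneg (hg x).1
  have hbij : Function.Bijective g' := by
    rw [Fintype.bijective_iff_injective_and_card]
    refine ⟨fun x y hxy => hinj (by simp) (by simp) ?_, by simp⟩
    rw [← hg', ← hg', hxy]
  refine ⟨f.trans (Equiv.ofBijective g' hbij), ?_⟩
  rw [sH_eq_sum_out, sH_eq_sum_out, ← Int.ofNat_le]
  push_cast
  rw [hw, hw fun x y => |g x - g y|] at hle
  refine hle.trans (Finset.sum_le_sum fun e _ => ?_)
  rw [← hg', ← hg']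
  exact abs_sub_le_dist_pathGraph _ _
end

section
/- Let G and H be finite simple graphs such that G is connected and |V(G)| = |V(H)| ≥ 2. Then h_H⁺(G) ≤ h_H⁺(P_{|V(G)|−1}). -/
open SimpleGraph

/-- `G.SpanningTreeOn S r`: the vertices of `S` carry a tree of edges of `G` rooted at `r`, built
by repeatedly hanging one rooted tree below the root of another. -/
inductive SimpleGraph.SpanningTreeOn {β : Type} [DecidableEq β] (G : SimpleGraph β) :
    Finset β → β → Prop
  | single (v : β) : SpanningTreeOn G {v} v
  | graft {S T : Finset β} {r s : β} : SpanningTreeOn G S r → SpanningTreeOn G T s →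
      Disjoint S T → G.Adj r s → SpanningTreeOn G (S ∪ T) r

namespace SimpleGraph.SpanningTreeOn

variable {β : Type} [DecidableEq β] {G : SimpleGraph β}

theorem root_mem {S : Finset β} {r : β} (h : G.SpanningTreeOn S r) : r ∈ S := by
  induction h with
  | single v => simp
  | graft _ _ _ _ ih _ => exact Finset.mem_union_left _ ih

theorem insert_leaf {S : Finset β} {r : β} (h : G.SpanningTreeOn S r) {x y : β} (hx : x ∈ S)
    (hy : y ∉ S) (hxy : G.Adj x y) : G.SpanningTreeOn (insert y S) r := by
  induction h with
  | single v =>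
    obtain rfl := Finset.mem_singleton.1 hx
    have := graft (single x) (single y) (by simpa [eq_comm] using hy) hxy
    rwa [Finset.union_comm, ← Finset.insert_eq] at this
  | @graft S T r s h₁ h₂ hd hrs ih₁ ih₂ =>
    rw [Finset.mem_union, not_or] at hy
    rcases Finset.mem_union.1 hx with hx | hx
    · rw [← Finset.insert_union]
      exact graft (ih₁ hx hy.1) h₂ (Finset.disjoint_insert_left.2 ⟨hy.2, hd⟩) hrs
    · rw [← Finset.union_insert]
      exact graft h₁ (ih₂ hx hy.2) (Finset.disjoint_insert_right.2 ⟨hy.1, hd⟩) hrs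

end SimpleGraph.SpanningTreeOn

theorem SimpleGraph.Connected.spanningTreeOn_univ {β : Type} [Fintype β] [DecidableEq β]
    {G : SimpleGraph β} (hG : G.Connected) (r : β) : G.SpanningTreeOn Finset.univ r := by
  classical
  obtain ⟨S, hS, hmax⟩ := Finset.exists_max_image
    (Finset.univ.filter fun S : Finset β => G.SpanningTreeOn S r) Finset.card
    ⟨{r}, by simpa using SpanningTreeOn.single r⟩
  replace hS : G.SpanningTreeOn S r := by simpa using hS
  suffices S = Finset.univ from this ▸ hS
  by_contra hne
  obtain ⟨z, hz⟩ : ∃ z, z ∉ S := by simpa [Finset.eq_univ_iff_forall] using hne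
  obtain ⟨p⟩ := hG.preconnected r z
  obtain ⟨d, -, hd₁, hd₂⟩ := p.exists_boundary_dart (S : Set β) (by simpa using hS.root_mem)
    (by simpa using hz)
  have hd₂' : d.snd ∉ S := by simpa using hd₂
  have hle := hmax (insert d.snd S)
    (by simpa using hS.insert_leaf (by simpa using hd₁) hd₂' d.adj)
  rw [Finset.card_insert_of_notMem hd₂'] at hle
  omega

/-- The total cost of the pairwise distances `D` with weights `w` and of the depths `e` with
weights `c` over the vertices of `S`. -/
def layoutCost {β : Type} (w : β → β → ℤ) (c : β → ℤ) (S : Finset β) (D : β → β → ℤ)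
    (e : β → ℤ) : ℤ :=
  ∑ x ∈ S, ∑ y ∈ S, w x y * D x y + ∑ x ∈ S, c x * e x

section Graft

variable {β : Type} [DecidableEq β]

/-- The depths in a rooted tree on `S` below whose root a second rooted tree is hung. -/
def graftDepth (S : Finset β) (e₁ e₂ : β → ℤ) (x : β) : ℤ :=
  if x ∈ S then e₁ x else 1 + e₂ x

/-- The distances in a rooted tree on `S` below whose root a second rooted tree is hung. -/
def graftDist (S : Finset β) (D₁ D₂ : β → β → ℤ) (e₁ e₂ : β → ℤ) (x y : β) : ℤ :=
  if x ∈ S then (if y ∈ S then D₁ x y else e₁ x + 1 + e₂ y)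
  else (if y ∈ S then e₁ y + 1 + e₂ x else D₂ x y)

theorem layoutCost_graft (w : β → β → ℤ) (c : β → ℤ) {S T : Finset β} (hd : Disjoint S T)
    (D₁ D₂ : β → β → ℤ) (e₁ e₂ : β → ℤ) :
    layoutCost w c (S ∪ T) (graftDist S D₁ D₂ e₁ e₂) (graftDepth S e₁ e₂) =
      layoutCost w (fun x => c x + ∑ y ∈ T, (w x y + w y x)) S D₁ e₁ +
      layoutCost w (fun y => c y + ∑ x ∈ S, (w x y + w y x)) T D₂ e₂ +
      ∑ y ∈ T, (c y + ∑ x ∈ S, (w x y + w y x)) := by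
  have hT : ∀ y ∈ T, y ∉ S := fun y hy hS => Finset.disjoint_left.1 hd hS hy
  have hSS : ∑ x ∈ S, ∑ y ∈ S, w x y * graftDist S D₁ D₂ e₁ e₂ x y =
      ∑ x ∈ S, ∑ y ∈ S, w x y * D₁ x y :=
    Finset.sum_congr rfl fun x hx => Finset.sum_congr rfl fun y hy => by simp [graftDist, hx, hy]
  have hST : ∑ x ∈ S, ∑ y ∈ T, w x y * graftDist S D₁ D₂ e₁ e₂ x y =
      ∑ x ∈ S, ∑ y ∈ T, (w x y * e₁ x + w x y + w x y * e₂ y) :=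
    Finset.sum_congr rfl fun x hx => Finset.sum_congr rfl fun y hy => by
      simp only [graftDist, hx, hT y hy, if_true, if_false]; ring
  have hTS : ∑ y ∈ T, ∑ x ∈ S, w y x * graftDist S D₁ D₂ e₁ e₂ y x =
      ∑ x ∈ S, ∑ y ∈ T, (w y x * e₁ x + w y x + w y x * e₂ y) := by
    rw [Finset.sum_comm]
    exact Finset.sum_congr rfl fun x hx => Finset.sum_congr rfl fun y hy => by
      simp only [graftDist, hx, hT y hy, if_true, if_false]; ring
  have hTT : ∑ x ∈ T, ∑ y ∈ T, w x y * graftDist S D₁ D₂ e₁ e₂ x y =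
      ∑ x ∈ T, ∑ y ∈ T, w x y * D₂ x y :=
    Finset.sum_congr rfl fun x hx => Finset.sum_congr rfl fun y hy => by
      simp [graftDist, hT x hx, hT y hy]
  have hS' : ∑ x ∈ S, c x * graftDepth S e₁ e₂ x = ∑ x ∈ S, c x * e₁ x :=
    Finset.sum_congr rfl fun x hx => by simp [graftDepth, hx]
  have hT' : ∑ x ∈ T, c x * graftDepth S e₁ e₂ x = ∑ x ∈ T, (c x + c x * e₂ x) :=
    Finset.sum_congr rfl fun x hx => by simp only [graftDepth, hT x hx, if_false]; ring
  have hswap : ∀ F : β → β → ℤ, ∑ y ∈ T, ∑ x ∈ S, F x y = ∑ x ∈ S, ∑ y ∈ T, F x y :=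
    fun F => Finset.sum_comm
  simp only [layoutCost, Finset.sum_union hd, Finset.sum_add_distrib, hSS, hTT, hST, hTS, hS', hT',
    add_mul, Finset.sum_mul, hswap fun x y => w x y, hswap fun x y => w y x,
    hswap fun x y => w x y * e₂ y, hswap fun x y => w y x * e₂ y]
  ring

end Graft

theorem SimpleGraph.Connected.layoutCost_dist_le_graft {β : Type} [DecidableEq β]
    {G : SimpleGraph β} (hG : G.Connected) {w : β → β → ℤ} (hw : ∀ x y, 0 ≤ w x y) {c : β → ℤ}
    (hc : ∀ x, 0 ≤ c x) (S U : Finset β) {r s : β} (hrs : G.Adj r s) :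
    layoutCost w c U (fun x y => G.dist x y) (fun x => G.dist r x) ≤
      layoutCost w c U
        (graftDist S (fun x y => G.dist x y) (fun x y => G.dist x y)
          (fun x => G.dist r x) (fun x => G.dist s x))
        (graftDepth S (fun x => G.dist r x) (fun x => G.dist s x)) := by
  have hroot : ∀ y, G.dist r y ≤ 1 + G.dist s y := fun y => by
    have := hG.dist_triangle (u := r) (v := s) (w := y)
    rwa [dist_eq_one_iff_adj.2 hrs] at this
  have hcross : ∀ x y, G.dist x y ≤ G.dist r x + 1 + G.dist s y := fun x y => by
    have h₁ := hG.dist_triangle (u := x) (v := r) (w := y)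
    have h₂ := hroot y
    rw [G.dist_comm (u := x) (v := r)] at h₁
    omega
  refine add_le_add (Finset.sum_le_sum fun x _ => Finset.sum_le_sum fun y _ =>
    mul_le_mul_of_nonneg_left ?_ (hw x y)) (Finset.sum_le_sum fun x _ =>
    mul_le_mul_of_nonneg_left ?_ (hc x))
  · have h₁ := hcross x y
    have h₂ := hcross y x
    rw [G.dist_comm (u := y) (v := x)] at h₂
    simp only [graftDist]
    split_ifs <;> omega
  · have := hroot x
    simp only [graftDepth]
    split_ifs <;> omega

/-- A linear layout of `S` at positions `0, …, |S| - 1`. -/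
def IsLayout {β : Type} (S : Finset β) (pos : β → ℤ) : Prop :=
  Set.InjOn pos S ∧ ∀ x ∈ S, 0 ≤ pos x ∧ pos x < S.card

/-- Two paths joined at their first vertices form a path; entering it at one of its two ends is
at least as costly as entering it at the first vertex of the first path. -/
theorem exists_layout_of_graft {β : Type} [DecidableEq β] {S T : Finset β} (hd : Disjoint S T)
    (hS : S.Nonempty) (hT : T.Nonempty) {p₁ p₂ : β → ℤ} (h₁ : IsLayout S p₁) (h₂ : IsLayout T p₂)
    (w : β → β → ℤ) {c : β → ℤ} (hc : ∀ x, 0 ≤ c x) :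
    ∃ pos, IsLayout (S ∪ T) pos ∧
      layoutCost w c (S ∪ T)
        (graftDist S (fun x y => |p₁ x - p₁ y|) (fun x y => |p₂ x - p₂ y|) p₁ p₂)
        (graftDepth S p₁ p₂) ≤
      layoutCost w c (S ∪ T) (fun x y => |pos x - pos y|) pos := by
  have hTS : ∀ y ∈ T, y ∉ S := fun y hy h => Finset.disjoint_left.1 hd h hy
  have hScard : (1 : ℤ) ≤ S.card := by exact_mod_cast hS.card_pos
  have hTcard : (1 : ℤ) ≤ T.card := by exact_mod_cast hT.card_pos
  obtain ⟨m, hm⟩ : ∃ m : ℤ, m = S.card := ⟨_, rfl⟩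
  obtain ⟨q, hq⟩ : ∃ q : ℤ, q = T.card := ⟨_, rfl⟩
  have hcard : ((S ∪ T).card : ℤ) = m + q := by
    rw [Finset.card_union_of_disjoint hd]; push_cast; rw [hm, hq]
  let f : β → ℤ := fun x => if x ∈ S then q + p₁ x else q - 1 - p₂ x
  let g : β → ℤ := fun x => if x ∈ S then m - 1 - p₁ x else m + p₂ x
  have hf : IsLayout (S ∪ T) f := by
    refine ⟨fun x hx y hy hxy => ?_, fun x hx => ?_⟩
    · simp only [Finset.coe_union, Set.mem_union, Finset.mem_coe] at hx hy
      rcases hx with hx | hx <;> rcases hy with hy | hy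
      · refine h₁.1 hx hy ?_
        simp only [f, hx, hy, if_true] at hxy
        omega
      · have := h₁.2 x hx
        have := h₂.2 y hy
        simp only [f, hx, hTS y hy, if_true, if_false] at hxy
        omega
      · have := h₂.2 x hx
        have := h₁.2 y hy
        simp only [f, hy, hTS x hx, if_true, if_false] at hxy
        omega
      · refine h₂.1 hx hy ?_
        simp only [f, hTS x hx, hTS y hy, if_false] at hxy
        omega
    · rw [hcard]
      rcases Finset.mem_union.1 hx with hx | hx
      · have := h₁.2 x hx
        simp only [f, hx, if_true]
        omega
      · have := h₂.2 x hx
        simp only [f, hTS x hx, if_false]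
        omega
  have hgf : ∀ x, g x = m + q - 1 - f x := fun x => by
    simp only [f, g]
    split_ifs <;> ring
  have hg : IsLayout (S ∪ T) g := by
    refine ⟨fun x hx y hy hxy => hf.1 hx hy ?_, fun x hx => ?_⟩
    · rw [hgf, hgf] at hxy
      omega
    · have := hf.2 x hx
      rw [hgf]
      omega
  have hDf : ∀ x ∈ S ∪ T, ∀ y ∈ S ∪ T,
      graftDist S (fun x y => |p₁ x - p₁ y|) (fun x y => |p₂ x - p₂ y|) p₁ p₂ x y =
        |f x - f y| := fun x hx y hy => by
    rcases Finset.mem_union.1 hx with hx | hx <;> rcases Finset.mem_union.1 hy with hy | hy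
    · simp [graftDist, f, hx, hy]
    · have := h₁.2 x hx
      have := h₂.2 y hy
      simp only [graftDist, f, hx, hTS y hy, if_true, if_false]
      rw [abs_of_nonneg (by omega)]
      ring
    · have := h₂.2 x hx
      have := h₁.2 y hy
      simp only [graftDist, f, hy, hTS x hx, if_true, if_false]
      rw [abs_of_nonpos (by omega)]
      ring
    · simp only [graftDist, f, hTS x hx, hTS y hy, if_false]
      rw [abs_sub_comm]
      congr 1
      ring
  have hDg : ∀ x ∈ S ∪ T, ∀ y ∈ S ∪ T,
      graftDist S (fun x y => |p₁ x - p₁ y|) (fun x y => |p₂ x - p₂ y|) p₁ p₂ x y =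
        |g x - g y| := fun x hx y hy => by
    rw [hDf x hx y hy, hgf, hgf, abs_sub_comm]
    congr 1
    ring
  have hcost : ∀ pos : β → ℤ, (∀ x ∈ S ∪ T, ∀ y ∈ S ∪ T,
      graftDist S (fun x y => |p₁ x - p₁ y|) (fun x y => |p₂ x - p₂ y|) p₁ p₂ x y =
        |pos x - pos y|) →
      ∑ x ∈ S ∪ T, c x * graftDepth S p₁ p₂ x ≤ ∑ x ∈ S ∪ T, c x * pos x →
      layoutCost w c (S ∪ T)
        (graftDist S (fun x y => |p₁ x - p₁ y|) (fun x y => |p₂ x - p₂ y|) p₁ p₂)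
        (graftDepth S p₁ p₂) ≤
      layoutCost w c (S ∪ T) (fun x y => |pos x - pos y|) pos := fun pos hD hle =>
    add_le_add (Finset.sum_le_sum fun x hx => Finset.sum_le_sum fun y hy =>
      (congrArg (w x y * ·) (hD x hx y hy)).le) hle
  have havg : (m - 1 + q) * ∑ x ∈ S ∪ T, c x * graftDepth S p₁ p₂ x ≤
      (m - 1) * ∑ x ∈ S ∪ T, c x * f x + q * ∑ x ∈ S ∪ T, c x * g x := by
    simp only [Finset.mul_sum]
    rw [← Finset.sum_add_distrib]
    refine Finset.sum_le_sum fun x hx => ?_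
    have key : (m - 1 + q) * graftDepth S p₁ p₂ x ≤ (m - 1) * f x + q * g x := by
      rcases Finset.mem_union.1 hx with hx | hx
      · have := h₁.2 x hx
        simp only [graftDepth, f, g, hx, if_true]
        nlinarith
      · have := h₂.2 x hx
        simp only [graftDepth, f, g, hTS x hx, if_false]
        nlinarith
    nlinarith [mul_le_mul_of_nonneg_left key (hc x)]
  rcases le_or_gt (∑ x ∈ S ∪ T, c x * graftDepth S p₁ p₂ x) (∑ x ∈ S ∪ T, c x * f x) with h | h
  · exact ⟨f, hf, hcost f hDf h⟩
  · refine ⟨g, hg, hcost g hDg ?_⟩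
    by_contra! h'
    nlinarith

theorem SimpleGraph.SpanningTreeOn.exists_layout {β : Type} [DecidableEq β] {G : SimpleGraph β}
    (hG : G.Connected) {w : β → β → ℤ} (hw : ∀ x y, 0 ≤ w x y) {S : Finset β} {r : β}
    (h : G.SpanningTreeOn S r) {c : β → ℤ} (hc : ∀ x, 0 ≤ c x) :
    ∃ pos, IsLayout S pos ∧
      layoutCost w c S (fun x y => G.dist x y) (fun x => G.dist r x) ≤
        layoutCost w c S (fun x y => |pos x - pos y|) pos := by
  induction h generalizing c with
  | single v => exact ⟨fun _ => 0, by simp [IsLayout], by simp [layoutCost]⟩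
  | @graft S T r s h₁ h₂ hd hrs ih₁ ih₂ =>
    have hsum : ∀ (U : Finset β) x, 0 ≤ c x + ∑ y ∈ U, (w x y + w y x) := fun U x =>
      add_nonneg (hc x) (Finset.sum_nonneg fun y _ => add_nonneg (hw x y) (hw y x))
    obtain ⟨p₁, hp₁, hle₁⟩ := ih₁ (hsum T)
    obtain ⟨p₂, hp₂, hle₂⟩ := ih₂ (c := fun y => c y + ∑ x ∈ S, (w x y + w y x))
      (fun y => by simpa only [add_comm (w y _)] using hsum S y)
    obtain ⟨pos, hpos, hle⟩ :=
      exists_layout_of_graft hd ⟨r, h₁.root_mem⟩ ⟨s, h₂.root_mem⟩ hp₁ hp₂ w hc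
    refine ⟨pos, hpos, (hG.layoutCost_dist_le_graft hw hc S (S ∪ T) hrs).trans (le_trans ?_ hle)⟩
    rw [layoutCost_graft w c hd, layoutCost_graft w c hd]
    linarith

theorem SimpleGraph.pathGraph_le_add_length {n : ℕ} {u v : Fin n} (p : (pathGraph n).Walk u v) :
    (v : ℕ) ≤ u + p.length ∧ (u : ℕ) ≤ v + p.length := by
  induction p with
  | nil => simp
  | cons h p ih =>
    rw [pathGraph_adj] at h
    simp only [Walk.length_cons]
    omega

theorem SimpleGraph.abs_sub_le_pathGraph_dist {n : ℕ} (u v : Fin n) :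
    |((u : ℕ) : ℤ) - (v : ℕ)| ≤ (pathGraph n).dist u v := by
  obtain ⟨p, hp⟩ := ((pathGraph_preconnected n) u v).exists_walk_length_eq_dist
  have := pathGraph_le_add_length p
  rw [abs_le]
  omega

theorem bddAbove_range_sH {α β : Type} [Fintype α] [Fintype β] (H : SimpleGraph α)
    (G : SimpleGraph β) : BddAbove {m | ∃ f : α ≃ β, sH H G ⇑f = m} := by
  classical
  exact (Set.finite_range fun f : α ≃ β => sH H G ⇑f).bddAbove

theorem exists_sH_le_sH_pathGraph {α β : Type} [Fintype α] [Fintype β]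
    (H : SimpleGraph α) {G : SimpleGraph β} (hG : G.Connected) (f : α ≃ β) :
    ∃ g : α ≃ Fin (Fintype.card β), sH H G f ≤ sH H (pathGraph (Fintype.card β)) g := by
  classical
  obtain ⟨r⟩ := hG.nonempty
  let E := H.edgeSet.toFinite.toFinset
  let w : β → β → ℤ := fun x y => ∑ e ∈ E, if f e.out.1 = x ∧ f e.out.2 = y then 1 else 0
  have hw : ∀ x y, 0 ≤ w x y := fun x y => Finset.sum_nonneg fun e _ => by split_ifs <;> simp
  have hsum : ∀ (D : β → β → ℤ) e, layoutCost w (fun _ => 0) Finset.univ D e =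
      ∑ e ∈ E, D (f e.out.1) (f e.out.2) := fun D e => by
    simp only [layoutCost, w, zero_mul, Finset.sum_const_zero, add_zero, Finset.sum_mul]
    simp only [Finset.sum_comm (t := E), ite_mul, one_mul, zero_mul, ite_and]
    simp
  obtain ⟨pos, ⟨hinj, hlt⟩, hle⟩ :=
    (hG.spanningTreeOn_univ r).exists_layout hG hw (c := fun _ => 0) (fun _ => le_rfl)
  rw [hsum, hsum] at hle
  let g : β → Fin (Fintype.card β) := fun x => ⟨(pos x).toNat, by
    have := hlt x (Finset.mem_univ x)
    rw [Finset.card_univ] at this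
    omega⟩
  have hg : ∀ x, ((g x : ℕ) : ℤ) = pos x := fun x =>
    Int.toNat_of_nonneg (hlt x (Finset.mem_univ x)).1
  have hgbij : Function.Bijective g := by
    refine (Fintype.bijective_iff_injective_and_card g).2 ⟨fun x y hxy => ?_, by simp⟩
    exact hinj (by simp) (by simp) (by rw [← hg, ← hg, hxy])
  refine ⟨f.trans (Equiv.ofBijective g hgbij), ?_⟩
  rw [sH_eq_sum_out, sH_eq_sum_out]
  zify
  refine hle.trans (Finset.sum_le_sum fun e _ => ?_)
  rw [← hg, ← hg]
  exact abs_sub_le_pathGraph_dist _ _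

theorem stmt9 {α β : Type} [Fintype α] [Fintype β]
    (H : SimpleGraph α) (G : SimpleGraph β) (hG : G.Connected)
    (hcard : Fintype.card α = Fintype.card β) (h2 : 2 ≤ Fintype.card β) :
    upperHH H G ≤ upperHH H (pathGraph (Fintype.card β)) := by
  obtain ⟨e⟩ := Fintype.card_eq.1 hcard
  refine csSup_le ⟨_, e, rfl⟩ ?_
  rintro _ ⟨f, rfl⟩
  obtain ⟨g, hg⟩ := exists_sH_le_sH_pathGraph H hG f
  exact hg.trans (le_csSup (bddAbove_range_sH H _) ⟨g, rfl⟩)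
end

section
/- Let G be a finite tree and H a connected finite simple graph with |V(G)| = |V(H)| ≥ 2, and suppose there is a pseudoordering f : V(H) → V(G) with s_H(f,G) = h_H⁺(P_{|V(G)|−1}). Then G is a path (G is isomorphic to P_{|V(G)|−1}). -/
open SimpleGraph

namespace SimpleGraph

variable {V : Type*} {G : SimpleGraph V}

/-- A function on the vertices that grows by at most one along each edge bounds distances from
below. -/
lemma Reachable.le_add_dist {φ : V → ℕ} (hφ : ∀ a b, G.Adj a b → φ b ≤ φ a + 1) {x y : V}
    (h : G.Reachable x y) : φ y ≤ φ x + G.dist x y := by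
  obtain ⟨w, hw⟩ := h.exists_walk_length_eq_dist
  rw [← hw]
  clear hw h
  induction w with
  | nil => simp
  | cons h w ih =>
    have := hφ _ _ h
    simp only [Walk.length_cons]
    omega

lemma Adj.dist_le_dist_add_one {a b : V} (h : G.Adj a b) (x : V) :
    G.dist x b ≤ G.dist x a + 1 := by
  have := h.diff_dist_adj (u := x)
  omega

lemma Connected.exists_adj_dist_eq (hG : G.Connected) {x y : V} {d : ℕ}
    (h : G.dist x y = d + 1) : ∃ z, G.Adj z y ∧ G.dist x z = d := by
  obtain ⟨w, hw⟩ := hG.exists_walk_length_eq_dist y x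
  rw [dist_comm, h] at hw
  cases w with
  | nil => simp at hw
  | @cons _ z _ hadj w =>
    refine ⟨z, hadj.symm, ?_⟩
    have h₁ := dist_le w
    rw [dist_comm] at h₁
    have h₂ := hadj.symm.dist_le_dist_add_one x
    simp only [Walk.length_cons] at hw
    omega

lemma IsTree.two_mul_dist_le (hG : G.IsTree) {v p q : V} (hp : G.Adj v p) (hq : G.Adj v q)
    (hpq : p ≠ q) (x : V) : 2 * G.dist v x ≤ G.dist p x + G.dist q x := by
  have h₁ := hG.dist_eq_dist_add_one_of_adj x hp
  have h₂ := hG.dist_eq_dist_add_one_of_adj x hq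
  rw [dist_comm, dist_comm (u := p), dist_comm (u := q)]
  by_contra! hlt
  have hp' : G.dist x v = G.dist x p + 1 := by omega
  have hq' : G.dist x v = G.dist x q + 1 := by omega
  obtain ⟨w₁, hw₁⟩ := hG.connected.exists_walk_length_eq_dist p x
  obtain ⟨w₂, hw₂⟩ := hG.connected.exists_walk_length_eq_dist q x
  have hc₁ : (Walk.cons hp w₁).IsPath := Walk.isPath_of_length_eq_dist _ (by
    rw [Walk.length_cons, hw₁, dist_comm, dist_comm (u := v), hp'])
  have hc₂ : (Walk.cons hq w₂).IsPath := Walk.isPath_of_length_eq_dist _ (by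
    rw [Walk.length_cons, hw₂, dist_comm, dist_comm (u := v), hq'])
  have := congrArg Walk.snd ((hG.existsUnique_path v x).unique hc₁ hc₂)
  simp only [Walk.snd_cons] at this
  exact hpq this

/-- The graph obtained from `G` by replacing the edge between `v` and `r` by an edge between
`r` and `p`. -/
def replaceEdge (G : SimpleGraph V) (v r p : V) : SimpleGraph V :=
  G.deleteEdges {s(v, r)} ⊔ edge r p

section replaceEdge

variable {v r p : V}

lemma Connected.reachable_deleteEdges (hG : G.Connected) (v r x : V) :
    (G.deleteEdges {s(v, r)}).Reachable r x ∨ (G.deleteEdges {s(v, r)}).Reachable v x := by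
  obtain ⟨w⟩ := hG x v
  induction w with
  | nil => exact Or.inr .rfl
  | @cons a b c h w ih =>
    by_cases he : s(a, b) = s(c, r)
    · rcases Sym2.eq_iff.mp he with ⟨rfl, -⟩ | ⟨rfl, -⟩
      · exact Or.inr .rfl
      · exact Or.inl .rfl
    · have hba : (G.deleteEdges {s(c, r)}).Reachable b a :=
        (Adj.symm (by simpa [deleteEdges_adj, h] using he)).reachable
      exact ih.imp (·.trans hba) (·.trans hba)

lemma IsTree.not_reachable_deleteEdges (hG : G.IsTree) (hr : G.Adj v r) :
    ¬ (G.deleteEdges {s(v, r)}).Reachable v r :=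
  isBridge_iff.mp (isAcyclic_iff_forall_adj_isBridge.mp hG.isAcyclic hr)

lemma reachable_deleteEdges_of_adj (hp : G.Adj v p) (hpr : p ≠ r) :
    (G.deleteEdges {s(v, r)}).Reachable v p := by
  refine Adj.reachable ?_
  simp [deleteEdges_adj, hp, hpr, hp.ne']

lemma IsTree.replaceEdge (hG : G.IsTree) (hr : G.Adj v r) (hp : G.Adj v p) (hpr : p ≠ r) :
    (G.replaceEdge v r p).IsTree := by
  have hvp := reachable_deleteEdges_of_adj (r := r) hp hpr
  refine ⟨?_, ?_⟩
  · have hle : G.deleteEdges {s(v, r)} ≤ G.replaceEdge v r p := le_sup_left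
    have hrp : (G.replaceEdge v r p).Reachable r p :=
      Adj.reachable (Or.inr (by simp [edge_adj, hpr.symm]))
    have hall (x : V) : (G.replaceEdge v r p).Reachable r x := by
      rcases hG.connected.reachable_deleteEdges v r x with h | h
      · exact h.mono hle
      · exact hrp.trans ((hvp.symm.trans h).mono hle)
    have : Nonempty V := ⟨v⟩
    exact ⟨fun x y => (hall x).symm.trans (hall y)⟩
  · refine IsAcyclic.sup_edge_of_not_reachable (fun h => ?_)
      (hG.isAcyclic.anti (deleteEdges_le _))
    exact hG.not_reachable_deleteEdges hr (hvp.trans h.symm)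

/-- An edge of `G.replaceEdge v r p` is either an edge of `G` not separated by deleting `v r`,
or the new edge. -/
lemma replaceEdge_adj_cases {a b : V} (h : (G.replaceEdge v r p).Adj a b) :
    (G.Adj a b ∧ ((G.deleteEdges {s(v, r)}).Reachable r a ↔
      (G.deleteEdges {s(v, r)}).Reachable r b)) ∨ (a = r ∧ b = p) ∨ (a = p ∧ b = r) := by
  rcases h with h | h
  · exact Or.inl ⟨deleteEdges_le _ h, ⟨(·.trans h.reachable), (·.trans h.symm.reachable)⟩⟩
  · exact Or.inr ((edge_adj _ _ _ _).mp h).1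

lemma IsTree.not_reachable_deleteEdges_of_adj (hG : G.IsTree) (hr : G.Adj v r)
    (hp : G.Adj v p) (hpr : p ≠ r) : ¬ (G.deleteEdges {s(v, r)}).Reachable r p := fun h =>
  hG.not_reachable_deleteEdges hr ((reachable_deleteEdges_of_adj hp hpr).trans h.symm)

open Classical in
/-- Functions on the two sides of a deleted edge, each growing by at most one along edges, glue to
a function bounding distances after replacing that edge. -/
lemma IsTree.ite_le_add_dist_replaceEdge (hG : G.IsTree) (hr : G.Adj v r) (hp : G.Adj v p)
    (hpr : p ≠ r) {φ ψ : V → ℕ} (hφ : ∀ a b, G.Adj a b → φ b ≤ φ a + 1)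
    (hψ : ∀ a b, G.Adj a b → ψ b ≤ ψ a + 1) (h₁ : φ r ≤ ψ p + 1) (h₂ : ψ p ≤ φ r + 1) (x y : V) :
    (if (G.deleteEdges {s(v, r)}).Reachable r y then φ y else ψ y) ≤
      (if (G.deleteEdges {s(v, r)}).Reachable r x then φ x else ψ x) +
        (G.replaceEdge v r p).dist x y := by
  have hrp := hG.not_reachable_deleteEdges_of_adj hr hp hpr
  have hrr : (G.deleteEdges {s(v, r)}).Reachable r r := .rfl
  refine Reachable.le_add_dist
    (φ := fun z => if (G.deleteEdges {s(v, r)}).Reachable r z then φ z else ψ z) ?_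
    ((hG.replaceEdge hr hp hpr).connected x y)
  intro a b hab
  rcases replaceEdge_adj_cases hab with ⟨hab, h⟩ | ⟨rfl, rfl⟩ | ⟨rfl, rfl⟩
  · by_cases ha : (G.deleteEdges {s(v, r)}).Reachable r a
    · simpa [ha, h.mp ha] using hφ a b hab
    · simpa [ha, mt h.mpr ha] using hψ a b hab
  · simpa [hrp] using h₂
  · simpa [hrp] using h₁

lemma IsTree.dist_le_dist_replaceEdge (hG : G.IsTree) (hr : G.Adj v r) (hp : G.Adj v p)
    (hpr : p ≠ r) {x y : V} (hxy : (G.deleteEdges {s(v, r)}).Reachable r x ↔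
      (G.deleteEdges {s(v, r)}).Reachable r y) :
    G.dist x y ≤ (G.replaceEdge v r p).dist x y := by
  by_cases hx : (G.deleteEdges {s(v, r)}).Reachable r x
  · have := hG.ite_le_add_dist_replaceEdge hr hp hpr (φ := G.dist x)
      (ψ := fun z => G.dist x r + 1 + G.dist p z)
      (fun a b hab => hab.dist_le_dist_add_one x)
      (fun a b hab => by have := hab.dist_le_dist_add_one p; omega)
      (by omega) (by simp) x y
    simpa [hx, hxy.mp hx] using this
  · have := hG.ite_le_add_dist_replaceEdge hr hp hpr (ψ := G.dist x)
      (φ := fun z => G.dist x p + 1 + G.dist r z)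
      (fun a b hab => by have := hab.dist_le_dist_add_one r; omega)
      (fun a b hab => hab.dist_le_dist_add_one x)
      (by simp) (by omega) x y
    simpa [hx, mt hxy.mpr hx] using this

lemma IsTree.add_dist_le_dist_replaceEdge (hG : G.IsTree) (hr : G.Adj v r) (hp : G.Adj v p)
    (hpr : p ≠ r) {x y : V} (hx : (G.deleteEdges {s(v, r)}).Reachable r x)
    (hy : ¬ (G.deleteEdges {s(v, r)}).Reachable r y) :
    G.dist x r + 1 + G.dist p y ≤ (G.replaceEdge v r p).dist x y := by
  have := hG.ite_le_add_dist_replaceEdge hr hp hpr (φ := G.dist x)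
    (ψ := fun z => G.dist x r + 1 + G.dist p z)
    (fun a b hab => hab.dist_le_dist_add_one x)
    (fun a b hab => by have := hab.dist_le_dist_add_one p; omega)
    (by omega) (by simp) x y
  simpa [hx, hy] using this

variable {q : V}

lemma IsTree.two_mul_dist_add_le (hG : G.IsTree) (hr : G.Adj v r) (hp : G.Adj v p)
    (hq : G.Adj v q) (hpr : p ≠ r) (hqr : q ≠ r) {x y : V}
    (hx : (G.deleteEdges {s(v, r)}).Reachable r x)
    (hy : ¬ (G.deleteEdges {s(v, r)}).Reachable r y) :
    2 * G.dist x y + (G.dist p y + G.dist q y) ≤ (G.replaceEdge v r p).dist x y +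
      (G.replaceEdge v r q).dist x y + 2 * G.dist v y := by
  have h₁ := hG.add_dist_le_dist_replaceEdge hr hp hpr hx hy
  have h₂ := hG.add_dist_le_dist_replaceEdge hr hq hqr hx hy
  have h₃ := hG.connected.dist_triangle (u := x) (v := r) (w := y)
  have h₄ := hG.connected.dist_triangle (u := r) (v := v) (w := y)
  have h₅ := dist_eq_one_iff_adj.mpr hr.symm
  omega

lemma IsTree.two_mul_dist_le_dist_replaceEdge (hG : G.IsTree) (hr : G.Adj v r)
    (hp : G.Adj v p) (hq : G.Adj v q) (hpr : p ≠ r) (hqr : q ≠ r) (hpq : p ≠ q) (x y : V) :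
    2 * G.dist x y ≤ (G.replaceEdge v r p).dist x y + (G.replaceEdge v r q).dist x y := by
  by_cases hxy : (G.deleteEdges {s(v, r)}).Reachable r x ↔
      (G.deleteEdges {s(v, r)}).Reachable r y
  · have h₁ := hG.dist_le_dist_replaceEdge hr hp hpr hxy
    have h₂ := hG.dist_le_dist_replaceEdge hr hq hqr hxy
    omega
  · by_cases hx : (G.deleteEdges {s(v, r)}).Reachable r x
    · have h₁ := hG.two_mul_dist_add_le hr hp hq hpr hqr hx (fun hy => hxy (iff_of_true hx hy))
      have h₂ := hG.two_mul_dist_le hp hq hpq y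
      omega
    · have hy : (G.deleteEdges {s(v, r)}).Reachable r y := by
        by_contra hy
        exact hxy (by simp [hx, hy])
      have h₁ := hG.two_mul_dist_add_le hr hp hq hpr hqr hy hx
      have h₂ := hG.two_mul_dist_le hp hq hpq x
      rw [dist_comm, dist_comm (u := x), dist_comm (u := x)]
      omega

lemma IsTree.two_mul_dist_lt_dist_replaceEdge (hG : G.IsTree) (hr : G.Adj v r)
    (hp : G.Adj v p) (hq : G.Adj v q) (hpr : p ≠ r) (hqr : q ≠ r) {u : V}
    (hu : (G.deleteEdges {s(v, r)}).Reachable r u) :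
    2 * G.dist v u < (G.replaceEdge v r p).dist v u + (G.replaceEdge v r q).dist v u := by
  have h := hG.two_mul_dist_add_le hr hp hq hpr hqr hu
    (fun h => hG.not_reachable_deleteEdges hr h.symm)
  rw [dist_eq_one_iff_adj.mpr hp.symm, dist_eq_one_iff_adj.mpr hq.symm, dist_self] at h
  rw [dist_comm, dist_comm (u := v), dist_comm (u := v)]
  omega

end replaceEdge

lemma Connected.exists_adj_reachable_deleteEdges (hG : G.Connected) {v u : V} (h : v ≠ u) :
    ∃ r, G.Adj v r ∧ (G.deleteEdges {s(v, r)}).Reachable r u := by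
  obtain ⟨w, hw⟩ := hG.exists_isPath v u
  cases w with
  | nil => exact absurd rfl h
  | @cons _ r _ hr w =>
    rw [Walk.cons_isPath_iff] at hw
    refine ⟨r, hr, reachable_deleteEdges_iff_exists_walk.mpr ⟨w, fun he => hw.2 ?_⟩⟩
    exact Walk.fst_mem_support_of_mem_edges _ he

lemma IsTree.nonempty_iso_pathGraph [Fintype V] [Nontrivial V] (hG : G.IsTree)
    (hdeg : ∀ v a b c, G.Adj v a → G.Adj v b → G.Adj v c → a = b ∨ a = c ∨ b = c) :
    Nonempty (G ≃g pathGraph (Fintype.card V)) := by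
  classical
  obtain ⟨a, ha⟩ := hG.exists_vert_degree_one_of_nontrivial
  obtain ⟨z, -, hz⟩ := degree_eq_one_iff_existsUnique_adj.mp ha
  have hinj (d : ℕ) : ∀ x y, G.dist a x = d → G.dist a y = d → x = y := by
    induction d with
    | zero =>
      intro x y hx hy
      rw [hG.connected.dist_eq_zero_iff] at hx hy
      exact hx.symm.trans hy
    | succ d ih =>
      intro x y hx hy
      obtain ⟨x', hx', hdx⟩ := hG.connected.exists_adj_dist_eq hx
      obtain ⟨y', hy', hdy⟩ := hG.connected.exists_adj_dist_eq hy
      obtain rfl := ih _ _ hdx hdy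
      cases d with
      | zero =>
        obtain rfl := hG.connected.dist_eq_zero_iff.mp hdx
        rw [hz x hx', hz y hy']
      | succ d =>
        obtain ⟨t, ht, hdt⟩ := hG.connected.exists_adj_dist_eq hdx
        rcases hdeg x' x y t hx' hy' ht.symm with h | rfl | rfl
        · exact h
        · omega
        · omega
  have hdown (d : ℕ) : ∀ x, G.dist a x = d → ∀ k ≤ d, ∃ y, G.dist a y = k := by
    induction d with
    | zero => exact fun x hx k hk => ⟨x, by omega⟩
    | succ d ih =>
      intro x hx k hk
      rcases Nat.le_succ_iff.mp hk with hk | rfl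
      · obtain ⟨y, -, hy⟩ := hG.connected.exists_adj_dist_eq hx
        exact ih y hy k hk
      · exact ⟨x, hx⟩
  have hlt (x : V) : G.dist a x < Fintype.card V := by
    have hsub : Finset.range (G.dist a x + 1) ⊆ Finset.univ.image (G.dist a) := by
      intro k hk
      obtain ⟨y, hy⟩ := hdown _ x rfl k (Nat.lt_succ_iff.mp (Finset.mem_range.mp hk))
      exact Finset.mem_image.mpr ⟨y, Finset.mem_univ _, hy⟩
    have := (Finset.card_le_card hsub).trans Finset.card_image_le
    simpa using this
  let φ : V → Fin (Fintype.card V) := fun x => ⟨G.dist a x, hlt x⟩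
  have hφ : Function.Bijective φ := by
    rw [Fintype.bijective_iff_injective_and_card]
    exact ⟨fun x y h => hinj _ x y rfl (congrArg Fin.val h).symm, by simp⟩
  have hadj {x y : V} (h : G.dist a x + 1 = G.dist a y) : G.Adj x y := by
    obtain ⟨t, ht, hdt⟩ := hG.connected.exists_adj_dist_eq h.symm
    rwa [hinj _ x t rfl hdt]
  refine ⟨⟨Equiv.ofBijective φ hφ, ?_⟩⟩
  intro x y
  rw [Equiv.ofBijective_apply, Equiv.ofBijective_apply, pathGraph_adj]
  refine ⟨fun h => h.elim hadj fun h => (hadj h).symm, fun h => ?_⟩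
  have := hG.dist_eq_dist_add_one_of_adj a h
  simp only [φ]
  omega

lemma Iso.dist_map_le {W : Type*} {G' : SimpleGraph W} (hG : G.Connected) (φ : G ≃g G')
    (x y : V) : G'.dist (φ x) (φ y) ≤ G.dist x y := by
  obtain ⟨w, hw⟩ := hG.exists_walk_length_eq_dist x y
  rw [← hw, ← Walk.length_map φ.toHom w]
  exact dist_le _

lemma Iso.dist_map {W : Type*} {G' : SimpleGraph W} (hG : G.Connected) (φ : G ≃g G')
    (x y : V) : G'.dist (φ x) (φ y) = G.dist x y := by
  refine (φ.dist_map_le hG x y).antisymm ?_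
  simpa using φ.symm.dist_map_le (φ.connected_iff.mp hG) (φ x) (φ y)

end SimpleGraph

section sH

variable {α β γ : Type} [Fintype α]

lemma SimpleGraph.Iso.sH_comp {G : SimpleGraph β} {G' : SimpleGraph γ} (hG : G.Connected)
    (φ : G ≃g G') (H : SimpleGraph α) (f : α → β) : sH H G' (φ ∘ f) = sH H G f := by
  refine Finset.sum_congr rfl fun e _ => ?_
  induction e with
  | h x y => exact φ.dist_map hG _ _

lemma sH_le_upperHH [Finite β] (H : SimpleGraph α) (G : SimpleGraph β) (f : α ≃ β) :
    sH H G f ≤ upperHH H G :=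
  le_csSup (Set.finite_range fun f : α ≃ β => sH H G f).bddAbove ⟨f, rfl⟩

/-- If a tree has a vertex with three neighbours, some other tree on the same vertices has a
greater sum. -/
lemma SimpleGraph.IsTree.exists_isTree_sH_lt {H : SimpleGraph α} {G : SimpleGraph β}
    (hG : G.IsTree) (hH : H.Connected) (f : α ≃ β) {v a b c : β} (ha : G.Adj v a)
    (hb : G.Adj v b) (hc : G.Adj v c) (hab : a ≠ b) (hac : a ≠ c) (hbc : b ≠ c) :
    ∃ T : SimpleGraph β, T.IsTree ∧ sH H G f < sH H T f := by
  obtain ⟨u, hu⟩ : ∃ u, H.Adj (f.symm v) u := by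
    obtain ⟨u, hu, -⟩ := hH.exists_adj_reachable_deleteEdges (f.symm.injective.ne ha.ne)
    exact ⟨u, hu⟩
  have hvu : v ≠ f u := fun h => hu.ne (by simp [h])
  obtain ⟨r, hr, hru⟩ := hG.connected.exists_adj_reachable_deleteEdges hvu
  obtain ⟨p, q, hp, hq, hpr, hqr, hpq⟩ :
      ∃ p q, G.Adj v p ∧ G.Adj v q ∧ p ≠ r ∧ q ≠ r ∧ p ≠ q := by
    by_cases har : a = r
    · exact ⟨b, c, hb, hc, har ▸ hab.symm, har ▸ hac.symm, hbc⟩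
    by_cases hbr : b = r
    · exact ⟨a, c, ha, hc, har, hbr ▸ hbc.symm, hac⟩
    exact ⟨a, b, ha, hb, har, hbr, hab⟩
  have key : 2 * sH H G f < sH H (G.replaceEdge v r p) f + sH H (G.replaceEdge v r q) f := by
    unfold sH
    rw [Finset.mul_sum, ← Finset.sum_add_distrib]
    refine Finset.sum_lt_sum (fun e _ => ?_) ⟨s(f.symm v, u), by simpa using hu, ?_⟩
    · induction e with
      | h x y => exact hG.two_mul_dist_le_dist_replaceEdge hr hp hq hpr hqr hpq (f x) (f y)
    · simpa using hG.two_mul_dist_lt_dist_replaceEdge hr hp hq hpr hqr hru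
  by_cases h : sH H G f < sH H (G.replaceEdge v r p) f
  · exact ⟨_, hG.replaceEdge hr hp hpr, h⟩
  · exact ⟨_, hG.replaceEdge hr hq hqr, by omega⟩

end sH

theorem stmt10 {α β : Type} [Fintype α] [Fintype β]
    (H : SimpleGraph α) (G : SimpleGraph β) (hG : G.IsTree) (hH : H.Connected)
    (hcard : Fintype.card α = Fintype.card β) (h2 : 2 ≤ Fintype.card β)
    (f : α ≃ β)
    (hf : sH H G ⇑f = upperHH H (pathGraph (Fintype.card β))) :
    Nonempty (G ≃g pathGraph (Fintype.card β)) := by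
  have : Nontrivial β := Fintype.one_lt_card_iff_nontrivial.mp h2
  have : Nonempty {T : SimpleGraph β // T.IsTree} := ⟨⟨G, hG⟩⟩
  have path_of_max (T : SimpleGraph β) (hT : T.IsTree)
      (hmax : ∀ T' : SimpleGraph β, T'.IsTree → sH H T' f ≤ sH H T f) :
      Nonempty (T ≃g pathGraph (Fintype.card β)) := by
    refine hT.nonempty_iso_pathGraph fun v a b c ha hb hc => ?_
    by_contra! hne
    obtain ⟨T', hT', hlt⟩ := hT.exists_isTree_sH_lt hH f ha hb hc hne.1 hne.2.1 hne.2.2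
    exact (hmax T' hT').not_gt hlt
  obtain ⟨⟨T, hT⟩, hmax⟩ := Finite.exists_max
    fun T : {T : SimpleGraph β // T.IsTree} => sH H T.1 f
  obtain ⟨φ⟩ := path_of_max T hT fun T' hT' => hmax ⟨T', hT'⟩
  refine path_of_max G hG fun T' hT' => (hmax ⟨T', hT'⟩).trans ?_
  rw [hf, ← φ.sH_comp hT.connected H f]
  exact sH_le_upperHH H _ (f.trans φ.toEquiv)
end

section
/- Let G be a finite connected simple graph with |V(G)| ≥ 2 such that every spanning tree of G is a path. Then G is a path or a cycle (G is isomorphic to P_{|V(G)|−1} or to the cycle C_{|V(G)|}). -/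
open SimpleGraph

/-- If every spanning tree of a connected graph is a path, then no vertex of the graph has
three distinct neighbours: the star at that vertex extends to a spanning tree. -/
theorem SimpleGraph.Connected.eq_or_eq_or_eq_of_forall_isTree_iso_pathGraph {V : Type*} {n : ℕ}
    {G : SimpleGraph V} (hG : G.Connected)
    (hspan : ∀ T : SimpleGraph V, T ≤ G → T.IsTree → Nonempty (T ≃g pathGraph n))
    {v a b c : V} (ha : G.Adj v a) (hb : G.Adj v b) (hc : G.Adj v c) :
    a = b ∨ a = c ∨ b = c := by
  obtain ⟨T, hstar, hT, htree⟩ := hG.exists_isTree_le_of_le_of_isAcyclic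
    (inf_le_left : G ⊓ starGraph v ≤ G) ((isAcyclic_starGraph v).anti inf_le_right)
  obtain ⟨e⟩ := hspan T hT htree
  have key : ∀ {x : V}, G.Adj v x →
      (e v).val + 1 = (e x).val ∨ (e x).val + 1 = (e v).val := fun {x} hx =>
    pathGraph_adj.mp (e.map_adj_iff.mpr (hstar ⟨hx, starGraph_center_adj hx.ne⟩))
  have hA := key ha
  have hB := key hb
  have hC := key hc
  rw [← e.injective.eq_iff, ← e.injective.eq_iff, ← e.injective.eq_iff,
    Fin.ext_iff, Fin.ext_iff, Fin.ext_iff]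
  omega

theorem SimpleGraph.cycleGraph_adj_iff_val {n : ℕ} (hn : 2 ≤ n) {u v : Fin n} :
    (cycleGraph n).Adj u v ↔ (u.val + 1 = v.val ∨ v.val + 1 = u.val) ∨
      (u.val = 0 ∧ v.val + 1 = n) ∨ (v.val = 0 ∧ u.val + 1 = n) := by
  rw [cycleGraph_adj']
  have := u.isLt
  have := v.isLt
  rcases lt_trichotomy u v with h | rfl | h
  · rw [Fin.sub_val_of_le h.le, Fin.coe_sub_iff_lt.mpr h]
    rw [Fin.lt_def] at h
    omega
  · rw [Fin.sub_val_of_le le_rfl]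
    omega
  · rw [Fin.sub_val_of_le h.le, Fin.coe_sub_iff_lt.mpr h]
    rw [Fin.lt_def] at h
    omega

/-- A graph of maximum degree at most two containing the Hamiltonian path `0, 1, …, n - 1`
is that path or the cycle closing it. -/
theorem SimpleGraph.eq_pathGraph_or_eq_cycleGraph {n : ℕ} (hn : 2 ≤ n)
    {H : SimpleGraph (Fin n)} (hle : pathGraph n ≤ H)
    (hdeg : ∀ {v a b c : Fin n}, H.Adj v a → H.Adj v b → H.Adj v c → a = b ∨ a = c ∨ b = c) :
    H = pathGraph n ∨ H = cycleGraph n := by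
  have hinner : ∀ {u v : Fin n}, H.Adj u v → 0 < u.val → u.val + 1 < n →
      u.val + 1 = v.val ∨ v.val + 1 = u.val := by
    intro u v huv h0 h1
    have hp : H.Adj u ⟨u.val - 1, by omega⟩ := hle (pathGraph_adj.mpr (by simp; omega))
    have hs : H.Adj u ⟨u.val + 1, h1⟩ := hle (pathGraph_adj.mpr (by simp))
    have := hdeg huv hp hs
    simp only [Fin.ext_iff] at this
    omega
  have hsub : ∀ {u v : Fin n}, H.Adj u v → (u.val + 1 = v.val ∨ v.val + 1 = u.val) ∨
      (u.val = 0 ∧ v.val + 1 = n) ∨ (v.val = 0 ∧ u.val + 1 = n) := by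
    intro u v huv
    have hu := hinner huv
    have hv := hinner huv.symm
    have hne := Fin.val_ne_of_ne huv.ne
    omega
  by_cases hends : H.Adj ⟨0, by omega⟩ ⟨n - 1, by omega⟩
  · right
    ext u v
    rw [cycleGraph_adj_iff_val hn]
    refine ⟨hsub, ?_⟩
    rintro (h | ⟨h0, h1⟩ | ⟨h0, h1⟩)
    · exact hle (pathGraph_adj.mpr h)
    · convert hends; omega
    · convert hends.symm; omega
  · left
    ext u v
    refine ⟨fun huv => ?_, fun h => hle h⟩
    rw [pathGraph_adj]
    rcases hsub huv with h | ⟨h0, h1⟩ | ⟨h0, h1⟩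
    · exact h
    · refine absurd ?_ hends
      convert huv <;> omega
    · refine absurd ?_ hends
      convert huv.symm <;> omega

theorem stmt12 {V : Type} [Fintype V] (G : SimpleGraph V) (hG : G.Connected)
    (h2 : 2 ≤ Fintype.card V)
    (hspan : ∀ T : SimpleGraph V, T ≤ G → T.IsTree →
      Nonempty (T ≃g pathGraph (Fintype.card V))) :
    Nonempty (G ≃g pathGraph (Fintype.card V)) ∨
      Nonempty (G ≃g cycleGraph (Fintype.card V)) := by
  obtain ⟨T, hT, htree⟩ := hG.exists_isTree_le
  obtain ⟨e⟩ := hspan T hT htree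
  let f : G ≃g G.comap e.symm.toEquiv := (Iso.comap e.symm.toEquiv G).symm
  have hle : pathGraph (Fintype.card V) ≤ G.comap e.symm.toEquiv :=
    fun _ _ h => hT (e.symm.map_adj_iff.mpr h)
  have hdeg : ∀ {v a b c : Fin (Fintype.card V)}, (G.comap e.symm.toEquiv).Adj v a →
      (G.comap e.symm.toEquiv).Adj v b → (G.comap e.symm.toEquiv).Adj v c →
      a = b ∨ a = c ∨ b = c := by
    intro v a b c ha hb hc
    simpa using hG.eq_or_eq_or_eq_of_forall_isTree_iso_pathGraph hspan ha hb hc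
  rcases eq_pathGraph_or_eq_cycleGraph h2 hle hdeg with h | h
  · exact Or.inl ⟨h ▸ f⟩
  · exact Or.inr ⟨h ▸ f⟩
end

section
/- For every n ≥ 2, the upper Hamiltonian number of the path on n vertices satisfies h⁺(P_{n−1}) = ⌊n²/2⌋. -/
open SimpleGraph

/-- The weight `|2x - (n - 1)|` is twice the distance of the vertex `x` from the centre of the
path on `n` vertices. -/
def centreWeight (n : ℕ) (x : ℕ) : ℤ := |2 * (x : ℤ) - ((n : ℤ) - 1)|

theorem pathGraph_abs_sub_le_length {n : ℕ} {u v : Fin n} (w : (pathGraph n).Walk u v) :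
    |(u.val : ℤ) - v.val| ≤ w.length := by
  induction w with
  | nil => simp
  | cons h _ ih =>
    rw [pathGraph_adj] at h
    rw [Walk.length_cons]
    grind

theorem pathGraph_dist_le {n : ℕ} (u : Fin n) (k : ℕ) (h : u.val + k < n) :
    (pathGraph n).dist u ⟨u.val + k, h⟩ ≤ k := by
  induction k with
  | zero => simp
  | succ k ih =>
    have hadj : (pathGraph n).Adj ⟨u.val + k, by omega⟩ ⟨u.val + (k + 1), h⟩ := by
      rw [pathGraph_adj]
      exact Or.inl (by simp [add_assoc])
    have hreach := (pathGraph_preconnected n) u ⟨u.val + k, by omega⟩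
    obtain ⟨w, hw⟩ := hreach.exists_walk_length_eq_dist
    have := dist_le (w.concat hadj)
    have := ih (by omega)
    rw [Walk.length_concat] at *
    omega

theorem pathGraph_dist {n : ℕ} (u v : Fin n) :
    ((pathGraph n).dist u v : ℤ) = |(u.val : ℤ) - v.val| := by
  wlog huv : u.val ≤ v.val generalizing u v
  · rw [dist_comm, abs_sub_comm]
    exact this v u (by omega)
  apply le_antisymm
  · have h := pathGraph_dist_le u (v.val - u.val) (by omega)
    have hv : (⟨u.val + (v.val - u.val), by omega⟩ : Fin n) = v := Fin.ext (by simp; omega)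
    rw [hv] at h
    grind
  · obtain ⟨w, hw⟩ := ((pathGraph_preconnected n) u v).exists_walk_length_eq_dist
    rw [← hw]
    exact pathGraph_abs_sub_le_length w

theorem sum_centreWeight (n : ℕ) :
    ∑ k ∈ Finset.range n, centreWeight n k = ((n ^ 2 / 2 : ℕ) : ℤ) := by
  induction n using Nat.twoStepInduction with
  | zero => simp
  | one => simp [centreWeight]
  | more n ih _ =>
    have hshift (k : ℕ) : centreWeight (n + 2) (k + 1) = centreWeight n k := by
      unfold centreWeight
      push_cast
      congr 1
      ring
    have hfirst : centreWeight (n + 2) 0 = n + 1 := by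
      unfold centreWeight
      grind
    have hlast : centreWeight (n + 2) (n + 1) = n + 1 := by
      unfold centreWeight
      grind
    have hsq : (n + 2) ^ 2 / 2 = n ^ 2 / 2 + 2 * (n + 1) := by
      rw [show (n + 2) ^ 2 = n ^ 2 + 2 * (2 * (n + 1)) by ring]
      omega
    rw [Finset.sum_range_succ, Finset.sum_range_succ', hfirst, hlast, hsq]
    simp only [hshift, ih]
    push_cast
    ring

theorem sum_centreWeight_cyclic {n : ℕ} (f : Fin n ≃ Fin n) :
    ∑ i : Fin n, (centreWeight n (f i) +
      centreWeight n (f ⟨(i.val + 1) % n, Nat.mod_lt _ i.pos⟩)) = 2 * ((n ^ 2 / 2 : ℕ) : ℤ) := by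
  have hf : ∑ i : Fin n, centreWeight n (f i) = ((n ^ 2 / 2 : ℕ) : ℤ) := by
    rw [Equiv.sum_comp f (fun x : Fin n => centreWeight n x), ← sum_centreWeight,
      Fin.sum_univ_eq_sum_range]
  have hrot (i : Fin n) : (⟨(i.val + 1) % n, Nat.mod_lt _ i.pos⟩ : Fin n) = finRotate n i := by
    cases n with
    | zero => exact i.elim0
    | succ m => rw [finRotate_apply]; ext; simp [Fin.val_add]
  simp only [hrot]
  rw [Finset.sum_add_distrib, Equiv.sum_comp (finRotate n) (fun i => centreWeight n (f i)), hf]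
  ring

theorem cyclicSum_pathGraph_le {n : ℕ} (f : Fin n ≃ Fin n) :
    cyclicSum (pathGraph n) f ≤ n ^ 2 / 2 := by
  have h : 2 * (cyclicSum (pathGraph n) f : ℤ) ≤ 2 * ((n ^ 2 / 2 : ℕ) : ℤ) := by
    rw [← sum_centreWeight_cyclic f, cyclicSum, Nat.cast_sum, Finset.mul_sum]
    refine Finset.sum_le_sum fun i _ => ?_
    rw [pathGraph_dist]
    unfold centreWeight
    grind
  omega

/-- The ordering alternating between the lower half and the upper half of the path. -/
def zigzag (n : ℕ) (i : Fin n) : Fin n :=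
  ⟨if i.val % 2 = 0 then i.val / 2 else (n + 1) / 2 + i.val / 2, by split_ifs <;> omega⟩

theorem zigzag_injective (n : ℕ) : Function.Injective (zigzag n) := by
  intro i j h
  have := congrArg Fin.val h
  simp only [zigzag] at this
  ext
  split_ifs at this <;> omega

theorem cyclicSum_zigzag {n : ℕ} (f : Fin n ≃ Fin n) (hf : ∀ i, f i = zigzag n i) :
    cyclicSum (pathGraph n) f = n ^ 2 / 2 := by
  have h : 2 * (cyclicSum (pathGraph n) f : ℤ) = 2 * ((n ^ 2 / 2 : ℕ) : ℤ) := by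
    rw [← sum_centreWeight_cyclic f, cyclicSum, Nat.cast_sum, Finset.mul_sum]
    refine Finset.sum_congr rfl fun i _ => ?_
    rw [pathGraph_dist, hf, hf]
    simp only [zigzag, centreWeight, abs_eq_max_neg]
    have hi := i.isLt
    rcases Nat.lt_or_ge (i.val + 1) n with hlt | hge
    · rw [Nat.mod_eq_of_lt hlt]
      split_ifs <;> omega
    · rw [show i.val + 1 = n by omega, Nat.mod_self]
      split_ifs <;> omega
  omega

theorem stmt14 (n : ℕ) (hn : 2 ≤ n) :
    sSup {m | ∃ f : Fin n ≃ Fin n, cyclicSum (pathGraph n) ⇑f = m} = n ^ 2 / 2 := by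
  refine IsGreatest.csSup_eq ⟨?_, ?_⟩
  · exact ⟨Equiv.ofBijective _ (Finite.injective_iff_bijective.mp (zigzag_injective n)),
      cyclicSum_zigzag _ fun _ => rfl⟩
  · rintro _ ⟨f, rfl⟩
    exact cyclicSum_pathGraph_le f
end

section
/- Let G be a connected finite simple graph with n = |V(G)| ≥ 2. Then the upper traceable number satisfies t⁺(G) ≤ ⌊n²/2⌋ − 1, and equality holds if and only if G is a path (G is isomorphic to P_{n−1}). -/
open SimpleGraph

/-- A finite connected graph with an injective labelling by integers that changes by at most one
along each edge is a path. -/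
theorem nonempty_iso_pathGraph_of_injective {V : Type} [Fintype V] {G : SimpleGraph V}
    (hG : G.Connected) {n : ℕ} (hn : Fintype.card V = n) (φ : V → ℤ)
    (hinj : Function.Injective φ) (hadj : ∀ x y, G.Adj x y → |φ x - φ y| ≤ 1) :
    Nonempty (G ≃g pathGraph n) := by
  classical
  have hcross : ∀ u v k, φ u ≤ k → k < φ v → ∃ x y, G.Adj x y ∧ φ x = k ∧ φ y = k + 1 := by
    intro u v k hu hv
    obtain ⟨p⟩ := hG.preconnected u v
    obtain ⟨d, -, h1, h2⟩ := p.exists_boundary_dart {w | φ w ≤ k} hu (by simpa using hv)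
    have h3 := abs_le.1 (hadj _ _ d.adj)
    simp only [Set.mem_ofPred_eq, not_le] at h1 h2
    exact ⟨d.fst, d.snd, d.adj, by omega, by omega⟩
  have := hG.nonempty
  obtain ⟨v₀, hv₀⟩ := Finite.exists_min φ
  have hlt : ∀ v, (φ v - φ v₀).toNat < n := by
    intro v
    have hsub : Finset.range ((φ v - φ v₀).toNat + 1) ⊆
        Finset.univ.image fun w => (φ w - φ v₀).toNat := by
      intro i hi
      simp only [Finset.mem_range, Finset.mem_image, Finset.mem_univ, true_and] at hi ⊢
      rcases Nat.lt_or_ge i (φ v - φ v₀).toNat with h | h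
      · obtain ⟨x, -, -, hx, -⟩ := hcross v₀ v (φ v₀ + i) (by omega) (by omega)
        exact ⟨x, by omega⟩
      · exact ⟨v, by omega⟩
    have := (Finset.card_le_card hsub).trans Finset.card_image_le
    rw [Finset.card_range, Finset.card_univ, hn] at this
    omega
  let e : V → Fin n := fun v => ⟨(φ v - φ v₀).toNat, hlt v⟩
  have he : Function.Bijective e := by
    rw [Fintype.bijective_iff_injective_and_card]
    refine ⟨fun x y h => hinj ?_, by simp [hn]⟩
    have h' := congrArg Fin.val h
    have hx := hv₀ x
    have hy := hv₀ y
    simp only [e] at h'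
    omega
  refine ⟨⟨Equiv.ofBijective e he, ?_⟩⟩
  have hsucc : ∀ x y, φ x + 1 = φ y → G.Adj x y := by
    intro x y h
    obtain ⟨x', y', hxy, hx, hy⟩ := hcross x y (φ x) le_rfl (by omega)
    rwa [hinj hx, hinj (hy.trans h)] at hxy
  intro x y
  have hx := hv₀ x
  have hy := hv₀ y
  simp only [Equiv.ofBijective_apply, pathGraph_adj, e]
  constructor
  · rintro (h | h)
    · exact hsucc x y (by omega)
    · exact (hsucc y x (by omega)).symm
  · intro h
    have h1 := abs_le.1 (hadj _ _ h)
    have h2 : φ x ≠ φ y := fun h' => h.ne (hinj h')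
    omega

/-- Every intermediate distance is attained on a geodesic. -/
theorem SimpleGraph.Connected.exists_dist_eq_add {V : Type} {G : SimpleGraph V}
    (hG : G.Connected) (u v : V) {k : ℕ} (hk : k ≤ G.dist u v) :
    ∃ w, G.dist u w = k ∧ G.dist u v = k + G.dist w v := by
  obtain ⟨p, hp⟩ := hG.exists_walk_length_eq_dist u v
  have h1 := dist_le (p.take k)
  have h2 := dist_le (p.drop k)
  have h3 := hG.dist_triangle (u := u) (v := p.getVert k) (w := v)
  rw [Walk.take_length] at h1
  rw [Walk.drop_length] at h2
  exact ⟨p.getVert k, by omega, by omega⟩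

/-- If the layers around `c` have at most two vertices, and the vertices can be cyclically ordered
such that `c` lies on a geodesic between any two consecutive ones, then the graph is a path. -/
theorem nonempty_iso_pathGraph_of_geodesic {V : Type} [Fintype V] {G : SimpleGraph V}
    (hG : G.Connected) {n : ℕ} (hn : Fintype.card V = n) (c : V) (σ : Equiv.Perm V)
    (hσ : ∀ v, σ (σ v) ≠ v)
    (hgeo : ∀ v, G.dist c v + G.dist c (σ v) ≤ G.dist v (σ v))
    (hlayer : ∀ j, 1 ≤ j → ∀ x y z, G.dist c x = j → G.dist c y = j → G.dist c z = j →
      x = y ∨ x = z ∨ y = z) :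
    Nonempty (G ≃g pathGraph n) := by
  classical
  have tri := fun u v w => hG.dist_triangle (u := u) (v := v) (w := w)
  have comm := fun u v => G.dist_comm (u := u) (v := v)
  have hzero : ∀ v, G.dist c v = 0 → v = c := fun v h => (hG.dist_eq_zero_iff.1 h).symm
  let via : V → V → Prop := fun p v => G.dist c p = 1 ∧ G.dist c v = 1 + G.dist p v
  have hvia : ∀ v, v ≠ c → ∃ p, via p v := by
    intro v hv
    exact hG.exists_dist_eq_add c v (Nat.one_le_iff_ne_zero.2 fun h => hv (hzero v h))
  have hpartner : ∀ v, v ≠ c → ∃ y, y ≠ c ∧ G.dist c v + G.dist c y ≤ G.dist v y := by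
    intro v hv
    by_cases h : σ v = c
    · refine ⟨σ.symm v, fun h' => ?_, ?_⟩
      · have : v = σ c := by rw [← h', Equiv.apply_symm_apply]
        exact hσ c (by rw [← this, h])
      · have := hgeo (σ.symm v)
        rw [Equiv.apply_symm_apply, comm (σ.symm v) v] at this
        omega
    · exact ⟨σ v, h, hgeo v⟩
  have hne : ∀ x y p q, G.dist c x + G.dist c y ≤ G.dist x y → via p x → via q y → p ≠ q := by
    rintro x y p q h ⟨h1, h2⟩ ⟨h3, h4⟩ rfl
    have := tri x p y
    rw [comm x p] at this
    omega
  have hthree : ∀ p q r, G.dist c p = 1 → G.dist c q = 1 → G.dist c r = 1 →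
      p = q ∨ p = r ∨ q = r := hlayer 1 le_rfl
  have hviane : ∀ p v, via p v → v ≠ c := by
    rintro p v ⟨h1, h2⟩ rfl
    rw [dist_self] at h2
    omega
  have huniq : ∀ p q v, via p v → via q v → p = q := by
    intro p q v hp hq
    obtain ⟨y, hy, hvy⟩ := hpartner v (hviane _ _ hp)
    obtain ⟨r, hr⟩ := hvia y hy
    have h1 := hne _ _ _ _ hvy hp hr
    have h2 := hne _ _ _ _ hvy hq hr
    have := hthree p q r hp.1 hq.1 hr.1
    tauto
  have hmid : ∀ p t i, via p t → 1 ≤ i → i ≤ G.dist c t →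
      ∃ x, via p x ∧ G.dist c x = i ∧ G.dist c t = i + G.dist x t := by
    rintro p t i ⟨hp1, hp2⟩ hi hit
    obtain ⟨x, hx1, hx2⟩ := hG.exists_dist_eq_add p t (k := i - 1) (by omega)
    have h1 := tri c p x
    have h2 := tri c x t
    exact ⟨x, ⟨hp1, by omega⟩, by omega, by omega⟩
  have hinj : ∀ p u v, via p u → via p v → G.dist c u = G.dist c v → u = v := by
    intro p u v hu hv huv
    by_contra huv'
    have hu1 : 1 ≤ G.dist c u := by have := hu.2; omega
    have hle : (Finset.univ.filter fun x => via p x).card ≤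
        (Finset.univ.filter fun x => ¬ via p x).card := by
      apply Finset.card_le_card_of_injOn σ
      · intro x hx
        simp only [Finset.coe_filter, Finset.mem_univ, true_and, Set.mem_ofPred_eq] at hx ⊢
        exact fun h => hne _ _ _ _ (hgeo x) hx h rfl
      · exact σ.injective.injOn
    have hT : (Finset.univ.filter fun x => ¬ via p x).card ≤ (Finset.range (G.dist c u)).card := by
      apply Finset.card_le_card_of_injOn (G.dist c)
      · intro t ht
        simp only [Finset.coe_filter, Finset.mem_univ, true_and, Set.mem_ofPred_eq,
          Finset.coe_range, Set.mem_Iio] at ht ⊢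
        by_contra hlt
        have htc : t ≠ c := by
          rintro rfl
          rw [dist_self] at hlt
          omega
        obtain ⟨q, hq⟩ := hvia t htc
        obtain ⟨x, hx, hxl, -⟩ := hmid q t _ hq hu1 (not_lt.1 hlt)
        have hpq : p ≠ q := by rintro rfl; exact ht hq
        rcases hlayer _ hu1 u v x rfl huv.symm hxl with h | h | h
        · exact huv' h
        · subst h; exact hpq (huniq _ _ _ hu hx)
        · subst h; exact hpq (huniq _ _ _ hv hx)
      · intro s hs t ht hst
        simp only [Finset.coe_filter, Finset.mem_univ, true_and, Set.mem_ofPred_eq] at hs ht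
        by_cases hs0 : G.dist c s = 0
        · rw [hzero s hs0, hzero t (by omega)]
        have hsc : s ≠ c := by rintro rfl; simp at hs0
        have htc : t ≠ c := by
          rintro rfl
          rw [dist_self] at hst
          omega
        obtain ⟨q, hq⟩ := hvia s hsc
        obtain ⟨r, hr⟩ := hvia t htc
        by_cases hlt : G.dist c s ≤ G.dist c u
        · obtain ⟨x, hx, hxl, -⟩ := hmid p u _ hu (by omega) hlt
          rcases hlayer _ (by omega) s t x rfl hst.symm hxl with h | h | h
          · exact h
          · subst h; exact absurd hx hs
          · subst h; exact absurd hx ht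
        · obtain ⟨x, hx, hxl, -⟩ := hmid q s _ hq hu1 (by omega)
          have hpq : p ≠ q := by rintro rfl; exact hs hq
          rcases hlayer _ hu1 u v x rfl huv.symm hxl with h | h | h
          · exact absurd h huv'
          · subst h; exact absurd (huniq _ _ _ hu hx) hpq
          · subst h; exact absurd (huniq _ _ _ hv hx) hpq
    have hS : G.dist c u ≤ ((Finset.univ.filter fun x => via p x).erase v).card := by
      have hex : ∀ i, ∃ x, i < G.dist c u → via p x ∧ x ≠ v ∧ G.dist c x = i + 1 := by
        intro i
        by_cases hi : i < G.dist c u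
        · by_cases hi' : i + 1 = G.dist c u
          · exact ⟨u, fun _ => ⟨hu, huv', hi'.symm⟩⟩
          · obtain ⟨x, hx, hxl, -⟩ := hmid p u (i + 1) hu (by omega) hi
            refine ⟨x, fun _ => ⟨hx, ?_, hxl⟩⟩
            rintro rfl
            omega
        · exact ⟨u, fun h => absurd h hi⟩
      choose x hx using hex
      rw [← Finset.card_range (G.dist c u)]
      apply Finset.card_le_card_of_injOn x
      · intro i hi
        simp only [Finset.coe_range, Set.mem_Iio] at hi
        obtain ⟨h1, h2, -⟩ := hx i hi
        simp [h1, h2]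
      · intro i hi j hj hij
        simp only [Finset.coe_range, Set.mem_Iio] at hi hj
        have h1 := (hx i hi).2.2
        have h2 := (hx j hj).2.2
        rw [hij] at h1
        omega
    have hvS : v ∈ Finset.univ.filter fun x => via p x := by simpa using hv
    have := Finset.card_erase_add_one hvS
    rw [Finset.card_range] at hT
    omega
  have hstep : ∀ x y p, G.Adj x y → G.dist c y = G.dist c x + 1 → via p x → via p y := by
    intro x y p hxy hl hp
    refine ⟨hp.1, ?_⟩
    have h1 := tri p x y
    have h2 := tri c p y
    rw [dist_eq_one_iff_adj.2 hxy] at h1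
    have := hp.1
    have := hp.2
    omega
  have hsame : ∀ x y p q, G.Adj x y → G.dist c x = G.dist c y → via p x → via q y → p = q := by
    intro x y p q hxy hl hp hq
    by_contra hpq
    obtain ⟨z, hz, hxz⟩ := hpartner x (hviane _ _ hp)
    obtain ⟨r, hr⟩ := hvia z hz
    have hpr := hne _ _ _ _ hxz hp hr
    have hqr : q = r := by
      have := hthree p q r hp.1 hq.1 hr.1
      tauto
    subst hqr
    have h1 := tri x y z
    rw [dist_eq_one_iff_adj.2 hxy] at h1
    have hx1 := hp.2
    have hz1 := hr.2
    rcases le_total (G.dist c y) (G.dist c z) with h | h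
    · obtain ⟨w, hw, hwl, hwz⟩ := hmid q z _ hr (by omega) h
      rw [hinj q w y hw hq hwl] at hwz
      omega
    · obtain ⟨w, hw, hwl, hwz⟩ := hmid q y _ hq (by omega) h
      rw [hinj q w z hw hr hwl, comm z y] at hwz
      omega
  obtain ⟨a, ha⟩ : ∃ a, G.dist c a = 1 := by
    have : σ c ≠ c := fun h => hσ c (by rw [h, h])
    obtain ⟨a, ha⟩ := hvia _ this
    exact ⟨a, ha.1⟩
  refine nonempty_iso_pathGraph_of_injective hG hn
    (fun v => if via a v then (G.dist c v : ℤ) else -(G.dist c v : ℤ)) ?_ ?_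
  · intro x y hxy
    have hl : G.dist c x = G.dist c y := by
      dsimp only at hxy
      split_ifs at hxy <;> omega
    by_cases hx0 : G.dist c x = 0
    · rw [hzero x hx0, hzero y (by omega)]
    have hxc : x ≠ c := by rintro rfl; simp at hx0
    have hyc : y ≠ c := by
      rintro rfl
      rw [dist_self] at hl
      omega
    obtain ⟨q, hq⟩ := hvia x hxc
    obtain ⟨r, hr⟩ := hvia y hyc
    dsimp only at hxy
    split_ifs at hxy with h1 h2 h2
    · exact hinj a x y h1 h2 hl
    · omega
    · omega
    · have hqr : q = r := by
        have haq : a ≠ q := by rintro rfl; exact h1 hq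
        have har : a ≠ r := by rintro rfl; exact h2 hr
        have := hthree a q r ha hq.1 hr.1
        tauto
      subst hqr
      exact hinj q x y hq hr hl
  · have hcross : ∀ x y, G.Adj x y → via a x → ¬ via a y → y = c := by
      intro x y hxy hx hy
      by_contra hyc
      obtain ⟨q, hq⟩ := hvia y hyc
      have haq : a ≠ q := by rintro rfl; exact hy hq
      have h1 := tri c x y
      have h2 := tri c y x
      rw [comm y x] at h2
      rw [dist_eq_one_iff_adj.2 hxy] at h1 h2
      rcases lt_trichotomy (G.dist c x) (G.dist c y) with h | h | h
      · exact hy (hstep x y a hxy (by omega) hx)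
      · exact haq (hsame x y a q hxy h hx hq)
      · exact haq (huniq a q x hx (hstep y x q hxy.symm (by omega) hq))
    intro x y hxy
    have h1 := tri c x y
    have h2 := tri c y x
    rw [comm y x] at h2
    rw [dist_eq_one_iff_adj.2 hxy] at h1 h2
    rw [abs_le]
    split_ifs with hx hy hy
    · omega
    · have : G.dist c y = 0 := by rw [hcross x y hxy hx hy, dist_self]
      omega
    · have : G.dist c x = 0 := by rw [hcross y x hxy.symm hy hx, dist_self]
      omega
    · omega

/-- If `c` minimises the distance sum, at most half of the vertices are closer to a given
neighbour of `c` than to `c`. -/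
theorem two_mul_card_closer_le {V : Type} [Fintype V] {G : SimpleGraph V} (hG : G.Connected)
    {c c' : V} (hc : ∑ v, G.dist c v ≤ ∑ v, G.dist c' v) (h1 : G.dist c c' = 1) :
    2 * (Finset.univ.filter fun v => G.dist c' v < G.dist c v).card ≤ Fintype.card V := by
  have h : ∑ v, (G.dist c' v + 2 * if G.dist c' v < G.dist c v then 1 else 0) ≤
      ∑ v, (G.dist c v + 1) := by
    refine Finset.sum_le_sum fun v _ => ?_
    have := hG.dist_triangle (u := c') (v := c) (w := v)
    rw [G.dist_comm (u := c') (v := c)] at this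
    split_ifs <;> omega
  rw [Finset.sum_add_distrib, Finset.sum_add_distrib, ← Finset.mul_sum, ← Finset.card_filter,
    Finset.sum_const, Finset.card_univ, smul_eq_mul, mul_one] at h
  omega

/-- If `c` minimises the distance sum, then the number of vertices at distance more than `j`
from `c` is, if non-zero, at most the number of those in a path of the same order. -/
theorem card_dist_lt_add_le {V : Type} [Fintype V] {G : SimpleGraph V} (hG : G.Connected)
    {c : V} (hc : ∀ c', ∑ v, G.dist c v ≤ ∑ v, G.dist c' v) {j : ℕ} {u : V}
    (hu : j < G.dist c u) :
    (Finset.univ.filter fun v => j < G.dist c v).card + 2 * j + 1 ≤ Fintype.card V := by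
  classical
  have tri := fun u v w => hG.dist_triangle (u := u) (v := v) (w := w)
  by_cases hlayers : ∀ i, 1 ≤ i → i ≤ j → 2 ≤ (Finset.univ.filter fun v => G.dist c v = i).card
  · have hball : ∀ i, i ≤ j →
        2 * i + 1 ≤ (Finset.univ.filter fun v => G.dist c v ≤ i).card := by
      intro i
      induction i with
      | zero =>
        intro _
        exact Finset.card_pos.2 ⟨c, by simp⟩
      | succ i ih =>
        intro hi
        have h1 := ih (by omega)
        have h2 := hlayers (i + 1) (by omega) hi
        have hdisj : Disjoint (Finset.univ.filter fun v => G.dist c v ≤ i)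
            (Finset.univ.filter fun v => G.dist c v = i + 1) := by
          rw [Finset.disjoint_filter]
          intro v _ h
          omega
        have hunion : (Finset.univ.filter fun v => G.dist c v ≤ i) ∪
            (Finset.univ.filter fun v => G.dist c v = i + 1) =
            Finset.univ.filter fun v => G.dist c v ≤ i + 1 := by
          ext v
          simp only [Finset.mem_union, Finset.mem_filter, Finset.mem_univ, true_and]
          omega
        rw [← hunion, Finset.card_union_of_disjoint hdisj]
        omega
    have h1 := hball j le_rfl
    have h2 := Finset.card_filter_add_card_filter_not (s := (Finset.univ : Finset V))
      (fun v => j < G.dist c v)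
    simp only [not_lt, Finset.card_univ] at h2
    omega
  · push Not at hlayers
    obtain ⟨i, hi1, hij, hcard⟩ := hlayers
    obtain ⟨w, hw, hwu⟩ := hG.exists_dist_eq_add c u (k := i) (by omega)
    obtain ⟨c', hc1, hc'w⟩ := hG.exists_dist_eq_add c w (k := 1) (by omega)
    have hfar : ∀ v, i ≤ G.dist c v → G.dist c' v + 1 = G.dist c v := by
      intro v hv
      obtain ⟨w', hw', hw'v⟩ := hG.exists_dist_eq_add c v hv
      have hww : w' = w := Finset.card_le_one.1 (Nat.le_of_lt_succ hcard) _ (by simpa using hw')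
        _ (by simpa using hw)
      subst hww
      have h1 := tri c' w' v
      have h2 := tri c c' v
      omega
    have hK := two_mul_card_closer_le hG (hc c') hc1
    have hc'u := hfar u (by omega)
    have hex : ∀ k, ∃ x, k < j → G.dist c x = k + 1 ∧ G.dist c' x < G.dist c x := by
      intro k
      by_cases hk : k < j
      · obtain ⟨x, hx1, hx2⟩ := hG.exists_dist_eq_add c' u (k := k) (by omega)
        have h1 := tri c c' x
        have h2 := tri c x u
        exact ⟨x, fun _ => ⟨by omega, by omega⟩⟩
      · exact ⟨u, fun h => absurd h hk⟩
    choose x hx using hex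
    have hinj : Set.InjOn x (Finset.range j) := by
      intro k hk l hl hkl
      simp only [Finset.coe_range, Set.mem_Iio] at hk hl
      have h1 := (hx k hk).1
      have h2 := (hx l hl).1
      rw [hkl] at h1
      omega
    have hdisj : Disjoint ((Finset.range j).image x)
        (Finset.univ.filter fun v => j < G.dist c v) := by
      rw [Finset.disjoint_left]
      intro v hv hv'
      obtain ⟨k, hk, rfl⟩ := Finset.mem_image.1 hv
      have hkj := Finset.mem_range.1 hk
      have h1 := (hx k hkj).1
      simp only [Finset.mem_filter, Finset.mem_univ, true_and] at hv'
      omega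
    have hsub : (Finset.range j).image x ∪ (Finset.univ.filter fun v => j < G.dist c v) ⊆
        Finset.univ.filter fun v => G.dist c' v < G.dist c v := by
      intro v hv
      simp only [Finset.mem_union, Finset.mem_image, Finset.mem_range, Finset.mem_filter,
        Finset.mem_univ, true_and] at hv ⊢
      rcases hv with ⟨k, hk, rfl⟩ | hv
      · exact (hx k hk).2
      · have := hfar v (by omega)
        omega
    have hle := Finset.card_le_card hsub
    rw [Finset.card_union_of_disjoint hdisj, Finset.card_image_of_injOn hinj,
      Finset.card_range] at hle
    have hpos : 0 < (Finset.univ.filter fun v => j < G.dist c v).card :=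
      Finset.card_pos.2 ⟨u, by simpa using hu⟩
    omega

theorem sum_range_sub_two_mul (n : ℕ) : ∑ j ∈ Finset.range n, (n - 1 - 2 * j) = n ^ 2 / 4 := by
  induction n using Nat.twoStepInduction with
  | zero => rfl
  | one => rfl
  | more n ih _ =>
    rw [Finset.sum_range_succ', Finset.sum_range_succ]
    have h : ∀ j, n + 2 - 1 - 2 * (j + 1) = n - 1 - 2 * j := fun j => by omega
    simp only [h, ih]
    have : (n + 2) ^ 2 = n ^ 2 + 4 * n + 4 := by ring
    omega

/-- The distance sum of `c`, counted by layers. -/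
theorem sum_dist_eq_sum_card {V : Type} [Fintype V] {G : SimpleGraph V} (hG : G.Connected)
    {c : V} (hc : ∀ c', ∑ v, G.dist c v ≤ ∑ v, G.dist c' v) :
    ∑ v, G.dist c v = ∑ j ∈ Finset.range (Fintype.card V),
      (Finset.univ.filter fun v => j < G.dist c v).card := by
  simp only [Finset.card_filter]
  rw [Finset.sum_comm]
  refine Finset.sum_congr rfl fun v _ => ?_
  have hv : G.dist c v ≤ Fintype.card V := by
    by_contra h
    have := card_dist_lt_add_le hG hc (not_le.1 h)
    omega
  rw [← Finset.card_filter]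
  have : (Finset.range (Fintype.card V)).filter (fun j => j < G.dist c v) =
      Finset.range (G.dist c v) := by
    ext j
    simp only [Finset.mem_filter, Finset.mem_range]
    omega
  rw [this, Finset.card_range]

theorem card_dist_lt_le {V : Type} [Fintype V] {G : SimpleGraph V} (hG : G.Connected)
    {c : V} (hc : ∀ c', ∑ v, G.dist c v ≤ ∑ v, G.dist c' v) (j : ℕ) :
    (Finset.univ.filter fun v => j < G.dist c v).card ≤ Fintype.card V - 1 - 2 * j := by
  rcases Finset.eq_empty_or_nonempty (Finset.univ.filter fun v => j < G.dist c v) with h | ⟨u, hu⟩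
  · simp [h]
  · have := card_dist_lt_add_le hG hc (j := j) (u := u) (by simpa using hu)
    omega

theorem sum_dist_le_of_median {V : Type} [Fintype V] {G : SimpleGraph V} (hG : G.Connected)
    {c : V} (hc : ∀ c', ∑ v, G.dist c v ≤ ∑ v, G.dist c' v) :
    ∑ v, G.dist c v ≤ Fintype.card V ^ 2 / 4 := by
  rw [sum_dist_eq_sum_card hG hc, ← sum_range_sub_two_mul]
  exact Finset.sum_le_sum fun j _ => card_dist_lt_le hG hc j

/-- A median of extremal distance sum has at most two vertices in each layer around it. -/
theorem eq_or_eq_or_eq_of_sum_dist_eq {V : Type} [Fintype V] {G : SimpleGraph V}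
    (hG : G.Connected) {c : V} (hc : ∀ c', ∑ v, G.dist c v ≤ ∑ v, G.dist c' v)
    (hsum : ∑ v, G.dist c v = Fintype.card V ^ 2 / 4) (j : ℕ) (hj : 1 ≤ j) (x y z : V)
    (hx : G.dist c x = j) (hy : G.dist c y = j) (hz : G.dist c z = j) :
    x = y ∨ x = z ∨ y = z := by
  classical
  by_contra! h
  obtain ⟨hxy, hxz, hyz⟩ := h
  obtain ⟨i, rfl⟩ : ∃ i, j = i + 1 := ⟨j - 1, by omega⟩
  rw [sum_dist_eq_sum_card hG hc, ← sum_range_sub_two_mul] at hsum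
  have heq := (Finset.sum_eq_sum_iff_of_le fun j _ => card_dist_lt_le hG hc j).1 hsum
  have hdisj : Disjoint {x, y, z} (Finset.univ.filter fun v => i + 1 < G.dist c v) := by
    rw [Finset.disjoint_left]
    intro v hv hv'
    simp only [Finset.mem_insert, Finset.mem_singleton, Finset.mem_filter, Finset.mem_univ,
      true_and] at hv hv'
    rcases hv with rfl | rfl | rfl <;> omega
  have hsub : {x, y, z} ∪ (Finset.univ.filter fun v => i + 1 < G.dist c v) ⊆
      Finset.univ.filter fun v => i < G.dist c v := by
    intro v hv
    simp only [Finset.mem_union, Finset.mem_insert, Finset.mem_singleton, Finset.mem_filter,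
      Finset.mem_univ, true_and] at hv ⊢
    rcases hv with (rfl | rfl | rfl) | hv <;> omega
  have hle := Finset.card_le_card hsub
  rw [Finset.card_union_of_disjoint hdisj, Finset.card_eq_three.2 ⟨x, y, z, hxy, hxz, hyz, rfl⟩]
    at hle
  have h1 := card_dist_lt_le hG hc i
  have h2 := heq (i + 1) (Finset.mem_range.2 (by omega))
  omega

/-- Closing up an ordering to a cyclic one. -/
theorem openSum_add_dist {V : Type} [Fintype V] (G : SimpleGraph V) {k : ℕ}
    (f : Fin (k + 1) ≃ V) :
    openSum G f + G.dist (f (Fin.last k)) (f 0) =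
      ∑ v, G.dist v (((f.symm.trans (finRotate (k + 1))).trans f) v) := by
  rw [← Equiv.sum_comp f, Fin.sum_univ_castSucc, openSum, Fin.sum_univ_castSucc]
  simp only [Fin.val_castSucc, add_lt_add_iff_right, Fin.is_lt, dite_true, Fin.val_last,
    lt_irrefl, dite_false, add_zero, Equiv.trans_apply, Equiv.symm_apply_apply, finRotate_apply,
    Fin.coeSucc_eq_succ, Fin.last_add_one]
  rfl

theorem finRotate_finRotate_ne {k : ℕ} (hk : 2 ≤ k) (i : Fin (k + 1)) :
    finRotate (k + 1) (finRotate (k + 1) i) ≠ i := by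
  intro h
  have hi := i.isLt
  have h1 := coe_finRotate i
  have h2 := coe_finRotate (finRotate (k + 1) i)
  rw [h] at h2
  simp only [Fin.ext_iff, Fin.val_last, Nat.succ_eq_add_one] at h1 h2
  split_ifs at h1 h2 <;> omega

/-- The open sum of any ordering is less than `⌊n² / 2⌋`, and only in a path can it be
`⌊n² / 2⌋ - 1`. -/
theorem openSum_add_one_le_and_iso {V : Type} [Fintype V] {G : SimpleGraph V} (hG : G.Connected) {n : ℕ}
    (hn : Fintype.card V = n) (h2 : 2 ≤ n) (f : Fin n ≃ V) :
    openSum G f + 1 ≤ n ^ 2 / 2 ∧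
      (openSum G f + 1 = n ^ 2 / 2 → Nonempty (G ≃g pathGraph n)) := by
  obtain ⟨k, rfl⟩ : ∃ k, n = k + 1 := ⟨n - 1, by omega⟩
  have := hG.nonempty
  obtain ⟨c, hc⟩ := Finite.exists_min fun c => ∑ v, G.dist c v
  set σ := (f.symm.trans (finRotate (k + 1))).trans f with hσ
  have hclosed := openSum_add_dist G f
  rw [← hσ] at hclosed
  have hlast : 1 ≤ G.dist (f (Fin.last k)) (f 0) := by
    apply hG.pos_dist_of_ne
    rw [f.injective.ne_iff, ne_eq, Fin.ext_iff, Fin.val_last, Fin.val_zero]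
    omega
  have hpt : ∀ v ∈ Finset.univ, G.dist v (σ v) ≤ G.dist c v + G.dist c (σ v) := by
    intro v _
    rw [G.dist_comm (u := c) (v := v)]
    exact hG.dist_triangle
  have htotal : ∑ v, (G.dist c v + G.dist c (σ v)) = 2 * ∑ v, G.dist c v := by
    rw [Finset.sum_add_distrib, Equiv.sum_comp σ (G.dist c), two_mul]
  have hle := Finset.sum_le_sum hpt
  have hmed := sum_dist_le_of_median hG hc
  rw [hn] at hmed
  have hsq : (k + 1) ^ 2 / 2 = 2 * ((k + 1) ^ 2 / 4) := by
    rcases Nat.even_or_odd' (k + 1) with ⟨m, hm | hm⟩ <;> rw [hm]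
    · have : (2 * m) ^ 2 = 4 * m ^ 2 := by ring
      omega
    · have : (2 * m + 1) ^ 2 = 4 * (m ^ 2 + m) + 1 := by ring
      omega
  refine ⟨by omega, fun heq => ?_⟩
  rcases Nat.lt_or_ge k 2 with hk | hk
  · refine nonempty_iso_pathGraph_of_injective hG hn (fun v => ((f.symm v : ℕ) : ℤ)) ?_ ?_
    · intro x y h
      exact f.symm.injective (Fin.ext (Int.ofNat_inj.1 h))
    · intro x y _
      have h1 := (f.symm x).isLt
      have h2 := (f.symm y).isLt
      rw [abs_le]
      omega
  · have hgeo := (Finset.sum_eq_sum_iff_of_le hpt).1 (by omega)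
    refine nonempty_iso_pathGraph_of_geodesic hG hn c σ ?_
      (fun v => (hgeo v (Finset.mem_univ v)).ge)
      (eq_or_eq_or_eq_of_sum_dist_eq hG hc (by rw [hn]; omega))
    intro v h
    apply finRotate_finRotate_ne hk (f.symm v)
    apply f.injective
    simpa [hσ] using h

theorem abs_sub_le_dist_of_iso {V : Type} {G : SimpleGraph V} (hG : G.Connected) {n : ℕ}
    (φ : G ≃g pathGraph n) (u v : V) : |((φ u : ℕ) : ℤ) - (φ v : ℕ)| ≤ G.dist u v := by
  obtain ⟨p, hp⟩ := hG.exists_walk_length_eq_dist u v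
  rw [← hp]
  clear hp
  induction p with
  | nil => simp
  | cons h p ih =>
    have h1 := pathGraph_adj.1 (φ.map_adj_iff.2 h)
    rw [abs_le] at ih ⊢
    rw [Walk.length_cons]
    push_cast
    omega

/-- An injective self-map `g` of `{0, …, k}` yields an ordering of a path whose open sum is
at least that of the jumps of `g`. -/
theorem exists_sum_le_openSum {V : Type} {G : SimpleGraph V} (hG : G.Connected) {k : ℕ}
    (φ : G ≃g pathGraph (k + 1)) (g D : ℕ → ℕ) (hlt : ∀ i, i < k + 1 → g i < k + 1)
    (hinj : ∀ i j, i < k + 1 → j < k + 1 → g i = g j → i = j)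
    (hD : ∀ i, i < k → D i + g i ≤ g (i + 1) ∨ D i + g (i + 1) ≤ g i) :
    ∃ f : Fin (k + 1) ≃ V, ∑ i ∈ Finset.range k, D i ≤ openSum G f := by
  let e : Fin (k + 1) → Fin (k + 1) := fun i => ⟨g i, hlt i i.isLt⟩
  have he : Function.Bijective e := by
    rw [← Finite.injective_iff_bijective]
    intro i j h
    exact Fin.ext (hinj i j i.isLt j.isLt (congrArg Fin.val h))
  refine ⟨(Equiv.ofBijective e he).trans φ.symm.toEquiv, ?_⟩
  rw [openSum, Fin.sum_univ_castSucc, ← Fin.sum_univ_eq_sum_range]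
  refine le_add_right (Finset.sum_le_sum fun i _ => ?_)
  have h := hD i i.isLt
  rw [dif_pos (by simp)]
  have h1 := abs_le.1 (abs_sub_le_dist_of_iso hG φ (φ.symm (e i.castSucc)) (φ.symm (e i.succ)))
  rw [φ.apply_symm_apply, φ.apply_symm_apply] at h1
  change D i ≤ G.dist (φ.symm (e i.castSucc)) (φ.symm (e i.succ))
  simp only [e, Fin.val_castSucc, Fin.val_succ] at h1 ⊢
  omega

theorem sum_range_two_mul_ite (p q k : ℕ) :
    ∑ i ∈ Finset.range (2 * k), (if i % 2 = 0 then p else q) = k * (p + q) := by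
  induction k with
  | zero => simp
  | succ k ih =>
    rw [Nat.mul_succ, Finset.sum_range_succ, Finset.sum_range_succ, ih, if_pos (by omega),
      if_neg (by omega)]
    ring

/-- A path has an ordering attaining the upper bound. -/
theorem exists_le_openSum_of_iso {V : Type} {G : SimpleGraph V} (hG : G.Connected) {n : ℕ}
    (h2 : 2 ≤ n) (φ : G ≃g pathGraph n) : ∃ f : Fin n ≃ V, n ^ 2 / 2 - 1 ≤ openSum G f := by
  rcases Nat.even_or_odd' n with ⟨m, rfl | rfl⟩
  · obtain ⟨l, rfl⟩ : ∃ l, m = l + 1 := ⟨m - 1, by omega⟩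
    obtain ⟨f, hf⟩ := exists_sum_le_openSum (k := 2 * l + 1) hG φ
      (fun i => if i % 2 = 0 then l + 1 + i / 2 else i / 2)
      (fun i => if i % 2 = 0 then l + 1 else l + 2)
      (fun i hi => by split_ifs <;> omega)
      (fun i j hi hj h => by split_ifs at h <;> omega)
      (fun i hi => by split_ifs <;> omega)
    refine ⟨f, le_trans ?_ hf⟩
    rw [Finset.sum_range_succ, sum_range_two_mul_ite, if_pos (by omega)]
    have h1 : (2 * (l + 1)) ^ 2 = 4 * (l * l) + 8 * l + 4 := by ring
    have h3 : l * (l + 1 + (l + 2)) = 2 * (l * l) + 3 * l := by ring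
    omega
  · obtain ⟨l, rfl⟩ : ∃ l, m = l + 1 := ⟨m - 1, by omega⟩
    obtain ⟨f, hf⟩ := exists_sum_le_openSum (k := 2 * (l + 1)) hG φ
      (fun i => if i = 0 then l + 1 else if i % 2 = 0 then i / 2 - 1 else l + 1 + (i + 1) / 2)
      (fun i => if i = 0 then 1 else if i % 2 = 0 then l + 3 else l + 2)
      (fun i hi => by split_ifs <;> omega)
      (fun i j hi hj h => by split_ifs at h <;> omega)
      (fun i hi => by split_ifs <;> first | contradiction | omega)
    refine ⟨f, le_trans ?_ hf⟩
    have hshift : ∀ i, (if i + 1 = 0 then 1 else if (i + 1) % 2 = 0 then l + 3 else l + 2) =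
        if i % 2 = 0 then l + 2 else l + 3 := by
      intro i
      rcases Nat.mod_two_eq_zero_or_one i with h | h <;> simp [Nat.add_mod, h]
    rw [show 2 * (l + 1) = 2 * l + 1 + 1 by ring, Finset.sum_range_succ']
    simp only [hshift]
    rw [Finset.sum_range_succ, sum_range_two_mul_ite, if_pos (by omega)]
    simp only [if_true]
    have h1 : (2 * l + 1 + 1 + 1) ^ 2 = 4 * (l * l) + 12 * l + 9 := by ring
    have h3 : l * (l + 2 + (l + 3)) = 2 * (l * l) + 5 * l := by ring
    omega

theorem stmt17 {V : Type} [Fintype V] (G : SimpleGraph V) (hG : G.Connected)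
    {n : ℕ} (hn : Fintype.card V = n) (h2 : 2 ≤ n) :
    sSup {m | ∃ f : Fin n ≃ V, openSum G ⇑f = m} ≤ n ^ 2 / 2 - 1 ∧
    (sSup {m | ∃ f : Fin n ≃ V, openSum G ⇑f = m} = n ^ 2 / 2 - 1 ↔
      Nonempty (G ≃g pathGraph n)) := by
  have hle : ∀ m ∈ {m | ∃ f : Fin n ≃ V, openSum G ⇑f = m}, m ≤ n ^ 2 / 2 - 1 := by
    rintro m ⟨f, rfl⟩
    have := (openSum_add_one_le_and_iso hG hn h2 f).1
    omega
  have hne : {m | ∃ f : Fin n ≃ V, openSum G ⇑f = m}.Nonempty :=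
    ⟨_, (Fintype.equivFinOfCardEq hn).symm, rfl⟩
  have hbdd : BddAbove {m | ∃ f : Fin n ≃ V, openSum G ⇑f = m} := ⟨_, hle⟩
  refine ⟨csSup_le hne hle, fun h => ?_, fun ⟨φ⟩ => ?_⟩
  · obtain ⟨f, hf⟩ := Nat.sSup_mem hne hbdd
    have hlt := openSum_add_one_le_and_iso hG hn h2 f
    exact hlt.2 (by omega)
  · obtain ⟨f, hf⟩ := exists_le_openSum_of_iso hG h2 φ
    exact le_antisymm (csSup_le hne hle) (hf.trans (le_csSup hbdd ⟨f, rfl⟩))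
end
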